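/- arXiv:1704.00745 — 8 statements merged into one kernel-verified Lean document; each statement's English description precedes it below -/
import Mathlib

section
/- Let G be a finite group and H a subgroup of G such that the interval [H,G] is a Boolean lattice. Then [H,G] is H-cyclic, i.e. there exists g ∈ G such that the subgroup generated by H and g is all of G. -/
/-- If the interval above `H` is distributive and `⟨H, a⟩`, `⟨H, b⟩` meet in `H`, then the single
element `a * b` generates their join over `H`. -/
theorem Subgroup.sup_closure_mul_eq_sup {G : Type*} [Group G] {H : Subgroup G}
    (hdistrib : ∀ K₁ K₂ K₃ : Subgroup G, H ≤ K₁ → H ≤ K₂ → H ≤ K₃ →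
      K₁ ⊓ (K₂ ⊔ K₃) = (K₁ ⊓ K₂) ⊔ (K₁ ⊓ K₃))
    {a b : G} (hab : (H ⊔ closure {b}) ⊓ (H ⊔ closure {a}) ≤ H) :
    H ⊔ closure {a * b} = (H ⊔ closure {b}) ⊔ (H ⊔ closure {a}) := by
  have hmem (g : G) : g ∈ H ⊔ closure {g} := mem_sup_right (mem_closure_singleton_self g)
  have hle {g : G} {K : Subgroup G} (hK : H ≤ K) (hg : g ∈ K) : H ⊔ closure {g} ≤ K :=
    sup_le hK (by simpa using hg)
  have hHle (g : G) : H ≤ H ⊔ closure {g} := le_sup_left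
  have ha := hmem a
  have hb := hmem b
  have hX := hmem (a * b)
  have hHL := hHle b
  have hHN := hHle a
  have hHX := hHle (a * b)
  generalize hL : H ⊔ closure {b} = L at *
  generalize hN : H ⊔ closure {a} = N at *
  generalize hX' : H ⊔ closure {a * b} = X at *
  refine le_antisymm ?_ ?_
  · rw [← hX']
    exact hle (hHL.trans le_sup_left) (mul_mem (mem_sup_right ha) (mem_sup_left hb))
  · have hXL : L ⊔ N ≤ X ⊔ L := by
      refine sup_le le_sup_right ?_
      rw [← hN]
      refine hle (hHL.trans le_sup_right) ?_
      simpa using mul_mem (mem_sup_left hX : a * b ∈ X ⊔ L) (inv_mem (mem_sup_right hb))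
    have hXN : L ⊔ N ≤ X ⊔ N := by
      refine sup_le ?_ le_sup_right
      rw [← hL]
      refine hle (hHN.trans le_sup_right) ?_
      simpa using mul_mem (inv_mem (mem_sup_right ha)) (mem_sup_left hX : a * b ∈ X ⊔ N)
    calc L ⊔ N ≤ (X ⊔ L) ⊓ (X ⊔ N) := le_inf hXL hXN
      _ = ((X ⊔ L) ⊓ X) ⊔ (N ⊓ (X ⊔ L)) := by
        rw [hdistrib _ _ _ (hHX.trans le_sup_left) hHX hHN, inf_comm _ N]
      _ = ((X ⊔ L) ⊓ X) ⊔ ((N ⊓ X) ⊔ (N ⊓ L)) := by rw [hdistrib N X L hHN hHX hHL]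
      _ ≤ X := sup_le inf_le_right
        (sup_le inf_le_right (((inf_comm N L).le.trans hab).trans hHX))

/-- If the interval above `H` is distributive and complemented, every intermediate subgroup of a
finite group is generated over `H` by a single element. -/
theorem Subgroup.exists_sup_closure_singleton_eq {G : Type*} [Group G] [Finite G] {H : Subgroup G}
    (hdistrib : ∀ K₁ K₂ K₃ : Subgroup G, H ≤ K₁ → H ≤ K₂ → H ≤ K₃ →
      K₁ ⊓ (K₂ ⊔ K₃) = (K₁ ⊓ K₂) ⊔ (K₁ ⊓ K₃))
    (hcompl : ∀ K : Subgroup G, H ≤ K →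
      ∃ K' : Subgroup G, H ≤ K' ∧ K ⊓ K' = H ∧ K ⊔ K' = ⊤)
    (K : Subgroup G) (hK : H ≤ K) : ∃ g : G, H ⊔ closure {g} = K := by
  induction K using WellFoundedLT.induction with
  | ind K ih =>
    rcases hK.eq_or_lt with rfl | hlt
    · exact ⟨1, by simp⟩
    obtain ⟨b, hbK, hbH⟩ := SetLike.exists_of_lt hlt
    have hLK : H ⊔ closure {b} ≤ K := sup_le hK (by simpa using hbK)
    have hbL : b ∈ H ⊔ closure {b} := mem_sup_right (mem_closure_singleton_self b)
    obtain ⟨L', hHL', hinf, hsup⟩ := hcompl (H ⊔ closure {b}) le_sup_left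
    have hbL' : b ∉ L' := fun h => hbH (hinf ▸ mem_inf.2 ⟨hbL, h⟩)
    obtain ⟨a, ha⟩ := ih (K ⊓ L')
      (inf_le_left.lt_of_ne fun h => hbL' (inf_eq_left.1 h hbK)) (le_inf hK hHL')
    refine ⟨a * b, ?_⟩
    rw [sup_closure_mul_eq_sup hdistrib
      (by rw [ha]; exact (inf_le_inf_left _ inf_le_right).trans hinf.le), ha]
    have h := hdistrib K (H ⊔ closure {b}) L' hK le_sup_left hHL'
    rwa [hsup, inf_top_eq, inf_eq_right.2 hLK, eq_comm] at h


/-- If the interval `[H,G]` of subgroups is a Boolean lattice (it is bounded by `H` and `G`,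
and we assume it is distributive and complemented), then it is `H`-cyclic: there is a
`g : G` with `⟨H, g⟩ = G`. -/
theorem stmt3 {G : Type*} [Group G] [Finite G] (H : Subgroup G)
    (hdistrib : ∀ K₁ K₂ K₃ : Subgroup G, H ≤ K₁ → H ≤ K₂ → H ≤ K₃ →
      K₁ ⊓ (K₂ ⊔ K₃) = (K₁ ⊓ K₂) ⊔ (K₁ ⊓ K₃))
    (hcompl : ∀ K : Subgroup G, H ≤ K →
      ∃ K' : Subgroup G, H ≤ K' ∧ K ⊓ K' = H ∧ K ⊔ K' = ⊤) :
    ∃ g : G, H ⊔ Subgroup.closure {g} = ⊤ := by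
  exact Subgroup.exists_sup_closure_singleton_eq hdistrib hcompl ⊤ le_top
end

section
/- (Ore, 1938) Let G be a finite group and H a subgroup of G such that the interval [H,G] is a distributive lattice. Then there exists g ∈ G such that ⟨H, g⟩ = G (equivalently, ⟨Hg⟩ = G). -/
/-- In a distributive interval `[H,G]`, the coatoms are meet-prime. -/
theorem Subgroup.le_or_le_of_inf_le_of_isCoatom {G : Type*} [Group G] {H : Subgroup G}
    (hdistrib : ∀ K₁ K₂ K₃ : Subgroup G, H ≤ K₁ → H ≤ K₂ → H ≤ K₃ →
      K₁ ⊓ (K₂ ⊔ K₃) = (K₁ ⊓ K₂) ⊔ (K₁ ⊓ K₃))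
    {A B M : Subgroup G} (hA : H ≤ A) (hB : H ≤ B) (hHM : H ≤ M) (hM : IsCoatom M)
    (h : A ⊓ B ≤ M) : A ≤ M ∨ B ≤ M := by
  by_contra! hAB
  have htop : M ⊔ B = ⊤ := hM.2 _ (left_lt_sup.2 hAB.2)
  have hd := hdistrib A M B hA hHM hB
  rw [htop, inf_top_eq] at hd
  exact hAB.1 (hd.le.trans (sup_le inf_le_right h))

/-- In a distributive interval `[H,G]`, a finite meet lying below a coatom has a term below it. -/
theorem Subgroup.exists_le_of_finset_inf_le_of_isCoatom {G : Type*} [Group G] {H : Subgroup G}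
    (hdistrib : ∀ K₁ K₂ K₃ : Subgroup G, H ≤ K₁ → H ≤ K₂ → H ≤ K₃ →
      K₁ ⊓ (K₂ ⊔ K₃) = (K₁ ⊓ K₂) ⊔ (K₁ ⊓ K₃))
    {M : Subgroup G} (hHM : H ≤ M) (hM : IsCoatom M) (S : Finset (Subgroup G))
    (hS : ∀ L ∈ S, H ≤ L) (h : S.inf id ≤ M) : ∃ L ∈ S, L ≤ M := by
  classical
  induction S using Finset.induction_on with
  | empty => exact absurd (top_le_iff.1 h) hM.1
  | insert L S _ ih =>
    rw [Finset.forall_mem_insert] at hS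
    rw [Finset.inf_insert, id] at h
    rw [Finset.exists_mem_insert]
    exact (le_or_le_of_inf_le_of_isCoatom hdistrib hS.1 (Finset.le_inf hS.2) hHM hM h).imp_right
      (ih hS.2)

/-- In a distributive interval `[H,G]`, an intermediate subgroup contained in none of finitely many
coatoms is not covered by them. -/
theorem Subgroup.exists_mem_forall_notMem_of_isCoatom {G : Type*} [Group G] {H : Subgroup G}
    (hdistrib : ∀ K₁ K₂ K₃ : Subgroup G, H ≤ K₁ → H ≤ K₂ → H ≤ K₃ →
      K₁ ⊓ (K₂ ⊔ K₃) = (K₁ ⊓ K₂) ⊔ (K₁ ⊓ K₃))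
    (S : Finset (Subgroup G)) (hS : ∀ M ∈ S, H ≤ M ∧ IsCoatom M)
    {K : Subgroup G} (hHK : H ≤ K) (hK : ∀ M ∈ S, ¬ K ≤ M) :
    ∃ g ∈ K, ∀ M ∈ S, g ∉ M := by
  classical
  induction S using Finset.induction_on generalizing K with
  | empty => exact ⟨1, K.one_mem, by simp⟩
  | insert M S hMS ih =>
    rw [Finset.forall_mem_insert] at hS hK
    obtain ⟨⟨hHM, hM⟩, hS⟩ := hS
    have hne : ∀ L ∈ S, L ≠ M := fun L hL h => hMS (h ▸ hL)
    obtain ⟨a, ⟨haK, haM⟩, haS⟩ := ih hS (le_inf hHK hHM) fun L hL h =>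
      (le_or_le_of_inf_le_of_isCoatom hdistrib hHK hHM (hS L hL).1 (hS L hL).2 h).elim
        (hK.2 L hL) fun hle => hne L hL ((hM.le_iff_eq (hS L hL).2.1).1 hle)
    have hinf : ¬ K ⊓ S.inf id ≤ M := fun h =>
      (le_or_le_of_inf_le_of_isCoatom hdistrib hHK
        (Finset.le_inf fun L hL => (hS L hL).1) hHM hM h).elim hK.1 fun h' => by
          obtain ⟨L, hL, hLM⟩ := exists_le_of_finset_inf_le_of_isCoatom hdistrib hHM hM S
            (fun L hL => (hS L hL).1) h'
          exact hne L hL (((hS L hL).2.le_iff_eq hM.1).1 hLM).symm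
    obtain ⟨b, ⟨hbK, hbS⟩, hbM⟩ := SetLike.not_le_iff_exists.1 hinf
    refine ⟨a * b, K.mul_mem haK hbK, ?_⟩
    rw [Finset.forall_mem_insert, M.mul_mem_cancel_left haM]
    refine ⟨hbM, fun L hL hab => haS L hL ?_⟩
    have hbL : b ∈ L := Finset.inf_le (f := id) hL hbS
    rwa [L.mul_mem_cancel_right hbL] at hab

/-- (Ore, 1938) If the interval `[H,G]` of intermediate subgroups of a finite group `G`
is a distributive lattice, then there exists `g : G` with `⟨H, g⟩ = G`. -/
theorem stmt6 {G : Type*} [Group G] [Finite G] (H : Subgroup G)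
    (hdistrib : ∀ K₁ K₂ K₃ : Subgroup G, H ≤ K₁ → H ≤ K₂ → H ≤ K₃ →
      K₁ ⊓ (K₂ ⊔ K₃) = (K₁ ⊓ K₂) ⊔ (K₁ ⊓ K₃)) :
    ∃ g : G, H ⊔ Subgroup.closure {g} = ⊤ := by
  classical
  have hfin : {M : Subgroup G | H ≤ M ∧ IsCoatom M}.Finite := Set.toFinite _
  obtain ⟨g, -, hg⟩ := Subgroup.exists_mem_forall_notMem_of_isCoatom hdistrib hfin.toFinset
    (fun M hM => hfin.mem_toFinset.1 hM) (K := ⊤) le_top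
    (fun M hM h => (hfin.mem_toFinset.1 hM).2.1 (top_le_iff.1 h))
  refine ⟨g, (eq_top_or_exists_le_coatom _).resolve_right ?_⟩
  rintro ⟨M, hM, hle⟩
  obtain ⟨hHM, hgM⟩ := sup_le_iff.1 hle
  exact hg M (hfin.mem_toFinset.2 ⟨hHM, hM⟩) (hgM (Subgroup.mem_closure_singleton_self g))
end

section
/- Let G be a finite group and H a subgroup with [H,G] Boolean. Let K be an atom of the interval [H,G] and let g ∈ G be such that ⟨K, g⟩ = G. Then there exists g' in the coset Kg such that ⟨H, g'⟩ = G. -/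
/-- Let `[H,G]` be a Boolean interval of subgroups of a finite group `G`
(it is bounded, and we assume it is distributive and complemented), let `K` be an atom
of `[H,G]` and `g : G` with `⟨K, g⟩ = G`.  Then there is `g'` in the coset `Kg`
such that `⟨H, g'⟩ = G`. -/
theorem stmt7 {G : Type*} [Group G] [Finite G] (H : Subgroup G)
    (hdistrib : ∀ K₁ K₂ K₃ : Subgroup G, H ≤ K₁ → H ≤ K₂ → H ≤ K₃ →
      K₁ ⊓ (K₂ ⊔ K₃) = (K₁ ⊓ K₂) ⊔ (K₁ ⊓ K₃))
    (hcompl : ∀ K : Subgroup G, H ≤ K →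
      ∃ K' : Subgroup G, H ≤ K' ∧ K ⊓ K' = H ∧ K ⊔ K' = ⊤)
    (K : Subgroup G)
    (hatom : H < K ∧ ∀ K' : Subgroup G, H < K' → K' ≤ K → K' = K)
    (g : G) (hg : K ⊔ Subgroup.closure {g} = ⊤) :
    ∃ k ∈ K, H ⊔ Subgroup.closure {k * g} = ⊤ := by
  obtain ⟨L, hHL, hinf, hsup⟩ := hcompl K hatom.1.le
  -- A translate outside the complement `L` of `K` generates `G` together with `H`.
  have key : ∀ k ∈ K, k * g ∉ L → H ⊔ Subgroup.closure {k * g} = ⊤ := by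
    intro k hk hkL
    set T := H ⊔ Subgroup.closure {k * g}
    have hHT : H ≤ T := le_sup_left
    have hkT : k * g ∈ T := le_sup_right (a := H) (Subgroup.mem_closure_singleton_self _)
    have hKT : K ⊔ T = ⊤ := by
      refine top_le_iff.mp (hg ▸ sup_le le_sup_left ((Subgroup.closure_le _).mpr ?_))
      have hkK : k ∈ K ⊔ T := le_sup_left (a := K) hk
      exact Set.singleton_subset_iff.mpr
        ((Subgroup.mul_mem_cancel_left _ hkK).mp (le_sup_right (a := K) hkT))
    have hLT : L ≤ T := by
      have h := hdistrib L K T hHL hatom.1.le hHT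
      rw [hKT, inf_top_eq, inf_comm L K, hinf, sup_eq_right.mpr (le_inf hHL hHT)] at h
      exact h.trans_le inf_le_right
    have hTK : T = (T ⊓ K) ⊔ L := by
      have h := hdistrib T K L hHT hatom.1.le hHL
      rwa [hsup, inf_top_eq, inf_eq_right.mpr hLT] at h
    rcases (le_inf hHT hatom.1.le).eq_or_lt with h | h
    · rw [← h, sup_eq_right.mpr hHL] at hTK
      exact absurd (hTK ▸ hkT) hkL
    · rwa [hatom.2 _ h inf_le_right, hsup] at hTK
  by_cases hgL : g ∈ L
  · obtain ⟨k, hk, hkH⟩ := SetLike.exists_of_lt hatom.1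
    refine ⟨k, hk, key k hk fun h => hkH ?_⟩
    exact hinf ▸ Subgroup.mem_inf.mpr ⟨hk, (Subgroup.mul_mem_cancel_right _ hgL).mp h⟩
  · exact ⟨1, K.one_mem, key 1 K.one_mem (by rwa [one_mul])⟩
end

section
/- Let G be a finite group and suppose there exists a chain of subgroups {e} = H₀ < H₁ < ⋯ < H_ℓ = G such that each interval [Hᵢ, Hᵢ₊₁] is top Boolean. Then G admits a generating set of cardinality at most ℓ. -/
/-- The interval `[A,B]` of intermediate subgroups is top Boolean: letting `t` be the meet
of the coatoms of `[A,B]` (which is `B` if there are none), the interval `[t,B]` is a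
Boolean lattice, i.e. (being bounded by `t` and `B`) it is distributive and complemented. -/
def IntervalTopBoolean {G : Type*} [Group G] (A B : Subgroup G) : Prop :=
  ∀ t : Subgroup G,
    t = B ⊓ sInf {M : Subgroup G | A ≤ M ∧ M < B ∧
        ∀ K : Subgroup G, M < K → K ≤ B → K = B} →
    (∀ K₁ K₂ K₃ : Subgroup G, t ≤ K₁ → K₁ ≤ B → t ≤ K₂ → K₂ ≤ B → t ≤ K₃ → K₃ ≤ B →
      K₁ ⊓ (K₂ ⊔ K₃) = (K₁ ⊓ K₂) ⊔ (K₁ ⊓ K₃)) ∧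
    (∀ K : Subgroup G, t ≤ K → K ≤ B →
      ∃ K' : Subgroup G, t ≤ K' ∧ K' ≤ B ∧ K ⊓ K' = t ∧ K ⊔ K' = B)

/-- **Ore's theorem** for relatively complemented distributive intervals: every member of the
interval `[t, B]` is generated over `t` by one element. -/
theorem exists_sup_zpowers_eq {G : Type*} [Group G] [Finite G] {t B : Subgroup G}
    (hdist : ∀ K₁ K₂ K₃ : Subgroup G, t ≤ K₁ → K₁ ≤ B → t ≤ K₂ → K₂ ≤ B → t ≤ K₃ → K₃ ≤ B →
      K₁ ⊓ (K₂ ⊔ K₃) = (K₁ ⊓ K₂) ⊔ (K₁ ⊓ K₃))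
    (hcompl : ∀ K : Subgroup G, t ≤ K → K ≤ B →
      ∃ K' : Subgroup G, t ≤ K' ∧ K' ≤ B ∧ K ⊓ K' = t ∧ K ⊔ K' = B)
    (K : Subgroup G) (htK : t ≤ K) (hKB : K ≤ B) :
    ∃ g : G, t ⊔ Subgroup.zpowers g = K := by
  induction K using WellFoundedLT.induction with
  | ind K ih =>
  by_cases hKt : K ≤ t
  · exact ⟨1, by simpa using le_antisymm htK hKt⟩
  obtain ⟨b, hbK, hbt⟩ := SetLike.not_le_iff_exists.mp hKt
  set L := t ⊔ Subgroup.zpowers b with hL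
  have htL : t ≤ L := le_sup_left
  have hbL : b ∈ L := (le_sup_right : _ ≤ L) (Subgroup.mem_zpowers b)
  have hLK : L ≤ K := sup_le htK (by simpa using hbK)
  obtain ⟨L', htL', hL'B, hinf, hsup⟩ := hcompl L htL (hLK.trans hKB)
  have hne : K ⊓ L' < K := by
    refine lt_of_le_of_ne inf_le_left fun h => hbt ?_
    rw [← hinf]
    exact ⟨hbL, inf_eq_left.mp h (hLK hbL)⟩
  obtain ⟨a, ha⟩ := ih (K ⊓ L') hne (le_inf htK htL') (inf_le_left.trans hKB)
  have haM : a ∈ K ⊓ L' := ha ▸ (le_sup_right : _ ≤ t ⊔ _) (Subgroup.mem_zpowers a)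
  set X := t ⊔ Subgroup.zpowers (a * b) with hX
  have htX : t ≤ X := le_sup_left
  have habX : a * b ∈ X := (le_sup_right : _ ≤ X) (Subgroup.mem_zpowers _)
  have hXK : X ≤ K := sup_le htK (by simpa using K.mul_mem haM.1 hbK)
  have ha_sup : a ∈ X ⊔ L := by
    have := (X ⊔ L).mul_mem ((le_sup_left : X ≤ X ⊔ L) habX)
      ((X ⊔ L).inv_mem ((le_sup_right : L ≤ X ⊔ L) hbL))
    simpa using this
  have haX : a ∈ X := by
    have hmem : a ∈ (K ⊓ L') ⊓ (X ⊔ L) := ⟨haM, ha_sup⟩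
    rw [hdist _ _ _ (le_inf htK htL') (inf_le_left.trans hKB) htX (hXK.trans hKB) htL
      (hLK.trans hKB)] at hmem
    refine (sup_le inf_le_right ?_ : (K ⊓ L') ⊓ X ⊔ (K ⊓ L') ⊓ L ≤ X) hmem
    calc (K ⊓ L') ⊓ L ≤ L ⊓ L' := le_inf inf_le_right (inf_le_left.trans inf_le_right)
      _ = t := hinf
      _ ≤ X := htX
  have hbX : b ∈ X := by simpa using X.mul_mem (X.inv_mem haX) habX
  refine ⟨a * b, le_antisymm hXK ?_⟩
  calc K = K ⊓ (L ⊔ L') := by rw [hsup, inf_eq_left.mpr hKB]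
    _ = (K ⊓ L) ⊔ (K ⊓ L') :=
      hdist _ _ _ htK hKB htL (hLK.trans hKB) htL' hL'B
    _ ≤ X := by
      refine sup_le (inf_le_right.trans (sup_le htX (by simpa using hbX))) ?_
      rw [← ha]
      exact sup_le htX (by simpa using haX)

/-- A top Boolean interval `[A, B]` of subgroups with `A ≤ B` has `B` generated
by `A` and one further element. -/
theorem IntervalTopBoolean.exists_sup_zpowers_eq {G : Type*} [Group G] [Finite G]
    {A B : Subgroup G} (h : IntervalTopBoolean A B) (hAB : A ≤ B) :
    ∃ g : G, A ⊔ Subgroup.zpowers g = B := by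
  obtain ⟨hdist, hcompl⟩ := h _ rfl
  obtain ⟨g, hg⟩ := _root_.exists_sup_zpowers_eq hdist hcompl B inf_le_left le_rfl
  refine ⟨g, ?_⟩
  have hgB : Subgroup.zpowers g ≤ B := le_sup_right.trans hg.le
  by_contra hne
  obtain ⟨M, hCM, hM⟩ := (Set.toFinite {M : Subgroup G | M < B}).exists_le_maximal
    (lt_of_le_of_ne (sup_le hAB hgB) hne)
  refine hM.prop.not_ge (hg.ge.trans (sup_le (inf_le_right.trans (sInf_le ?_))
    (le_sup_right.trans hCM)))
  refine ⟨le_sup_left.trans hCM, hM.prop, fun K hMK hKB => ?_⟩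
  by_contra hK
  exact hMK.not_ge (hM.le_of_ge (lt_of_le_of_ne hKB hK) hMK.le)

/-- If a finite group `G` has a chain of subgroups `{e} = H₀ < H₁ < ⋯ < H_ℓ = G` with each
interval `[Hᵢ, Hᵢ₊₁]` top Boolean, then `G` admits a generating set of cardinality at
most `ℓ`. -/
theorem stmt8 {G : Type*} [Group G] [Finite G] (ℓ : ℕ) (H : Fin (ℓ + 1) → Subgroup G)
    (h0 : H 0 = ⊥) (hlast : H (Fin.last ℓ) = ⊤) (hmono : StrictMono H)
    (hstep : ∀ i : Fin ℓ, IntervalTopBoolean (H i.castSucc) (H i.succ)) :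
    ∃ S : Finset G, S.card ≤ ℓ ∧ Subgroup.closure (S : Set G) = ⊤ := by
  classical
  have key : ∀ i : Fin (ℓ + 1),
      ∃ S : Finset G, S.card ≤ i ∧ Subgroup.closure (S : Set G) = H i := by
    intro i
    induction i using Fin.induction with
    | zero => exact ⟨∅, by simp, by simp [h0]⟩
    | succ i ih =>
      obtain ⟨S, hcard, hS⟩ := ih
      obtain ⟨g, hg⟩ := (hstep i).exists_sup_zpowers_eq (hmono i.castSucc_lt_succ).le
      refine ⟨insert g S, (Finset.card_insert_le g S).trans (by simpa using hcard), ?_⟩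
      rw [Finset.coe_insert, Set.insert_eq, Subgroup.closure_union, hS,
        ← Subgroup.zpowers_eq_closure, sup_comm, hg]
  simpa [hlast] using key (Fin.last ℓ)
end

section
/- Let G be a finite group and H a subgroup of G such that the interval [H,G] is bottom Boolean, i.e. the interval [H, b] is a Boolean lattice, where b is the join of the atoms of [H,G]. Then there exists an irreducible complex representation V of G such that the pointwise stabilizer of the fixed-point subspace V^H equals H, i.e. G₍V^H₎ = H. -/
open scoped InnerProductSpace

namespace LeftTranslation

variable {G : Type*} [Group G]

open Classical in
/-- Extension by zero of the restriction of a function to `M`. -/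
noncomputable def restrict (M : Subgroup G) : EuclideanSpace ℂ G →ₗ[ℂ] EuclideanSpace ℂ G where
  toFun f := WithLp.toLp 2 fun x => if x ∈ M then f x else 0
  map_add' _ _ := by ext x; by_cases h : x ∈ M <;> simp [h]
  map_smul' _ _ := by ext x; by_cases h : x ∈ M <;> simp [h]

open Classical in
@[simp]
theorem restrict_apply (M : Subgroup G) (f : EuclideanSpace ℂ G) (x : G) :
    restrict M f x = if x ∈ M then f x else 0 := rfl

variable [Fintype G]

/-- The left translation representation of `G` on the Hilbert space of functions on `G`. -/
noncomputable def rep (G : Type*) [Group G] [Fintype G] :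
    Representation ℂ G (EuclideanSpace ℂ G) where
  toFun g :=
    { toFun := fun f => WithLp.toLp 2 fun x => f (g⁻¹ * x)
      map_add' := fun _ _ => by ext; simp
      map_smul' := fun _ _ => by ext; simp }
  map_one' := by ext; simp
  map_mul' g h := by ext; simp [mul_assoc]

@[simp]
theorem rep_apply (g : G) (f : EuclideanSpace ℂ G) (x : G) : rep G g f x = f (g⁻¹ * x) := rfl

theorem inner_rep_rep (g : G) (f₁ f₂ : EuclideanSpace ℂ G) :
    ⟪rep G g f₁, rep G g f₂⟫_ℂ = ⟪f₁, f₂⟫_ℂ := by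
  simp only [PiLp.inner_apply, rep_apply]
  exact Fintype.sum_equiv (Equiv.mulLeft g⁻¹) _ _ fun _ => rfl

/-- A subspace is `L`-invariant when it is stable under translation by elements of `L`. -/
def Invariant (L : Subgroup G) (U : Submodule ℂ (EuclideanSpace ℂ G)) : Prop :=
  ∀ g ∈ L, ∀ f ∈ U, rep G g f ∈ U

/-- A function is `H`-fixed when it is invariant under translation by elements of `H`. -/
def Fixed (H : Subgroup G) (f : EuclideanSpace ℂ G) : Prop :=
  ∀ h ∈ H, rep G h f = f

theorem Invariant.orthogonal {L : Subgroup G} {U : Submodule ℂ (EuclideanSpace ℂ G)}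
    (hU : Invariant L U) : Invariant L Uᗮ := by
  intro g hg f hf
  rw [Submodule.mem_orthogonal] at hf ⊢
  intro u hu
  have := hf _ (hU g⁻¹ (inv_mem hg) u hu)
  rw [← inner_rep_rep g] at this
  simpa using this

theorem Invariant.inf {L : Subgroup G} {U W : Submodule ℂ (EuclideanSpace ℂ G)}
    (hU : Invariant L U) (hW : Invariant L W) : Invariant L (U ⊓ W) :=
  fun g hg f hf => ⟨hU g hg f hf.1, hW g hg f hf.2⟩

theorem Invariant.mono {L M : Subgroup G} (hML : M ≤ L) {U : Submodule ℂ (EuclideanSpace ℂ G)}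
    (hU : Invariant L U) : Invariant M U :=
  fun g hg => hU g (hML hg)

theorem Fixed.of_add {H : Subgroup G} {W : Submodule ℂ (EuclideanSpace ℂ G)}
    (hW : Invariant H W) {w w' : EuclideanSpace ℂ G} (hw : w ∈ W) (hw' : w' ∈ Wᗮ)
    (h : Fixed H (w + w')) : Fixed H w ∧ Fixed H w' := by
  have key : ∀ g ∈ H, rep G g w - w = 0 := by
    intro g hg
    have h₁ : rep G g w - w ∈ W := sub_mem (hW g hg w hw) hw
    have h₂ : w' - rep G g w' ∈ Wᗮ := sub_mem hw' (hW.orthogonal g hg w' hw')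
    have h₃ : rep G g w - w = w' - rep G g w' := by
      have := h g hg
      rw [map_add] at this
      rw [sub_eq_sub_iff_add_eq_add, this, add_comm]
    rw [← h₃] at h₂
    exact (Submodule.disjoint_def.1 W.orthogonal_disjoint) _ h₁ h₂
  refine ⟨fun g hg => sub_eq_zero.1 (key g hg), fun g hg => ?_⟩
  have := h g hg
  rw [map_add, sub_eq_zero.1 (key g hg)] at this
  exact add_left_cancel this

/-- If `a` moves some `H`-fixed vector of an invariant subspace, it moves an `H`-fixed vector of
some irreducible subspace of it. -/
theorem exists_irreducible_moved {H L : Subgroup G} (hHL : H ≤ L) (a : G)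
    (U : Submodule ℂ (EuclideanSpace ℂ G)) (hU : Invariant L U)
    (hmoved : ∃ u ∈ U, Fixed H u ∧ rep G a u ≠ u) :
    ∃ V ≤ U, Invariant L V ∧ (∀ W ≤ V, Invariant L W → W = ⊥ ∨ W = V) ∧
      ∃ u ∈ V, Fixed H u ∧ rep G a u ≠ u := by
  induction U using WellFoundedLT.induction with
  | ind U ih =>
  by_cases hirr : ∀ W ≤ U, Invariant L W → W = ⊥ ∨ W = U
  · exact ⟨U, le_rfl, hU, hirr, hmoved⟩
  push Not at hirr
  obtain ⟨W, hWU, hW, hW₀, hW₁⟩ := hirr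
  obtain ⟨u, hu, hfix, hne⟩ := hmoved
  obtain ⟨w, hw, w', hw', rfl⟩ := W.exists_add_mem_mem_orthogonal u
  obtain ⟨hf, hf'⟩ := Fixed.of_add (hW.mono hHL) hw hw' hfix
  by_cases hwa : rep G a w = w
  · have hlt : U ⊓ Wᗮ < U := by
      refine lt_of_le_of_ne inf_le_left fun h => hW₀ ?_
      have : W ≤ Wᗮ := hWU.trans (inf_eq_left.1 h)
      exact disjoint_self.1 (W.orthogonal_disjoint.mono_right this)
    obtain ⟨V, hV, h⟩ := ih _ hlt (hU.inf hW.orthogonal)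
      ⟨w', ⟨by simpa using sub_mem hu (hWU hw), hw'⟩, hf', fun h => hne (by simp [hwa, h])⟩
    exact ⟨V, hV.trans inf_le_left, h⟩
  · obtain ⟨V, hV, h⟩ := ih W (lt_of_le_of_ne hWU hW₁) hW ⟨w, hw, hf, hwa⟩
    exact ⟨V, hV.trans hWU, h⟩

theorem restrict_rep {M : Subgroup G} {g : G} (hg : g ∈ M) (f : EuclideanSpace ℂ G) :
    restrict M (rep G g f) = rep G g (restrict M f) := by
  ext x
  have := M.mul_mem_cancel_left (inv_mem hg) (y := x)
  by_cases hx : x ∈ M <;> simp_all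

/-- `X` is an irreducible `L`-invariant space of functions supported on `L`, with a nonzero
`H`-fixed vector, such that only elements of `H` fix all `H`-fixed vectors among those of `L`. -/
structure LinearlyPrimitive (H L : Subgroup G) (X : Submodule ℂ (EuclideanSpace ℂ G)) : Prop where
  support : ∀ f ∈ X, ∀ x ∉ L, f x = 0
  invariant : Invariant L X
  irreducible : ∀ W ≤ X, Invariant L W → W = ⊥ ∨ W = X
  exists_fixed : ∃ f ∈ X, Fixed H f ∧ f ≠ 0
  stabilizer : ∀ g ∈ L, (∀ f ∈ X, Fixed H f → rep G g f = f) → g ∈ H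

theorem rep_ne_of_support {M : Subgroup G} {f : EuclideanSpace ℂ G} (hf : ∀ x ∉ M, f x = 0)
    (hf₀ : f ≠ 0) {a : G} (ha : a ∉ M) : rep G a f ≠ f := by
  intro h
  refine hf₀ ?_
  ext y
  by_cases hy : y ∈ M
  · rw [← h, rep_apply]
    exact hf _ fun h' => ha (by simpa using M.mul_mem hy (inv_mem h'))
  · exact hf y hy

/-- The subspace of functions on `L` that is induced from a space `X` of functions on `M`. -/
noncomputable def induced (M L : Subgroup G) (X : Submodule ℂ (EuclideanSpace ℂ G)) :
    Submodule ℂ (EuclideanSpace ℂ G) where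
  carrier := {f | (∀ x ∉ L, f x = 0) ∧ ∀ t ∈ L, restrict M (rep G t f) ∈ X}
  add_mem' hf hg := ⟨fun x hx => by simp [hf.1 x hx, hg.1 x hx],
    fun t ht => by simpa using add_mem (hf.2 t ht) (hg.2 t ht)⟩
  zero_mem' := ⟨by simp, by simp⟩
  smul_mem' c f hf := ⟨fun x hx => by simp [hf.1 x hx],
    fun t ht => by simpa using X.smul_mem c (hf.2 t ht)⟩

theorem invariant_induced (M L : Subgroup G) (X : Submodule ℂ (EuclideanSpace ℂ G)) :
    Invariant L (induced M L X) := by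
  refine fun g hg f hf => ⟨fun x hx => ?_, fun t ht => ?_⟩
  · exact hf.1 _ fun h => hx ((L.mul_mem_cancel_left (inv_mem hg)).1 h)
  · have := hf.2 (t * g) (mul_mem ht hg)
    rwa [map_mul] at this

theorem le_induced {M L : Subgroup G} (hML : M ≤ L) {X : Submodule ℂ (EuclideanSpace ℂ G)}
    (hsupp : ∀ f ∈ X, ∀ x ∉ M, f x = 0) (hX : Invariant M X) : X ≤ induced M L X := by
  refine fun f hf => ⟨fun x hx => hsupp f hf x fun h => hx (hML h), fun t _ => ?_⟩
  by_cases htM : t ∈ M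
  · convert hX t htM f hf using 1
    ext x
    by_cases hx : x ∈ M
    · simp [hx]
    · simpa [hx] using (hsupp f hf _ fun h => hx ((M.mul_mem_cancel_left (inv_mem htM)).1 h)).symm
  · convert X.zero_mem using 1
    ext x
    by_cases hx : x ∈ M
    · simpa [hx] using hsupp f hf _ fun h => htM (by simpa using M.mul_mem hx (inv_mem h))
    · simp [hx]

/-- An irreducible subspace of the induced space restricts onto `X`, and `H`-fixed vectors
lift. -/
theorem exists_fixed_lift {H M L : Subgroup G} (hHM : H ≤ M) (hML : M ≤ L)
    {X U : Submodule ℂ (EuclideanSpace ℂ G)} (hX : ∀ W ≤ X, Invariant M W → W = ⊥ ∨ W = X)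
    (hUX : U ≤ induced M L X) (hU : Invariant L U) (hU₀ : U ≠ ⊥)
    {x : EuclideanSpace ℂ G} (hx : x ∈ X) (hxfix : Fixed H x) :
    ∃ u ∈ U, Fixed H u ∧ restrict M u = x := by
  have hmap : U.map (restrict M) = X := by
    refine (hX _ ?_ ?_).resolve_left fun h => ?_
    · rintro _ ⟨f, hf, rfl⟩
      simpa using (hUX hf).2 1 (one_mem _)
    · rintro g hg _ ⟨f, hf, rfl⟩
      exact ⟨rep G g f, hU g (hML hg) f hf, restrict_rep hg f⟩
    · obtain ⟨f, hf, hf₀⟩ := Submodule.exists_mem_ne_zero_of_ne_bot hU₀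
      refine hf₀ ?_
      ext y
      by_cases hy : y ∈ L
      · have h₁ : restrict M (rep G y⁻¹ f) ∈ U.map (restrict M) :=
          Submodule.mem_map_of_mem (hU _ (inv_mem hy) f hf)
        rw [h, Submodule.mem_bot] at h₁
        have h₂ := congrArg (fun k : EuclideanSpace ℂ G => k 1) h₁
        simpa [one_mem] using h₂
      · exact (hUX hf).1 y hy
  rw [← hmap] at hx
  obtain ⟨u, hu, rfl⟩ := hx
  set N := U ⊓ LinearMap.ker (restrict M) with hN
  have hNinv : Invariant H N := fun g hg f hf => ⟨hU g (hML (hHM hg)) f hf.1, by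
    rw [SetLike.mem_coe, LinearMap.mem_ker, restrict_rep (hHM hg), LinearMap.mem_ker.1 hf.2,
      map_zero]⟩
  obtain ⟨w, hw, w', hw', rfl⟩ := N.exists_add_mem_mem_orthogonal u
  have hres : restrict M (w + w') = restrict M w' := by
    rw [map_add, LinearMap.mem_ker.1 hw.2, zero_add]
  have hw'U : w' ∈ U := by simpa using sub_mem hu hw.1
  rw [hres] at hxfix ⊢
  refine ⟨w', hw'U, fun g hg => sub_eq_zero.1 ?_, rfl⟩
  refine (Submodule.disjoint_def.1 N.orthogonal_disjoint) _ ⟨?_, ?_⟩ ?_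
  · exact sub_mem (hU g (hML (hHM hg)) _ hw'U) hw'U
  · rw [SetLike.mem_coe, LinearMap.mem_ker, map_sub, restrict_rep (hHM hg), hxfix g hg, sub_self]
  · exact sub_mem (hNinv.orthogonal g hg _ hw') hw'

theorem LinearlyPrimitive.exists_extension {H M L : Subgroup G} (hHM : H ≤ M) (hML : M ≤ L)
    {X : Submodule ℂ (EuclideanSpace ℂ G)} (hX : LinearlyPrimitive H M X) {a : G} (ha : a ∉ M) :
    ∃ U : Submodule ℂ (EuclideanSpace ℂ G),
      (∀ f ∈ U, ∀ x ∉ L, f x = 0) ∧ Invariant L U ∧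
      (∀ W ≤ U, Invariant L W → W = ⊥ ∨ W = U) ∧
      (∃ f ∈ U, Fixed H f ∧ rep G a f ≠ f) ∧
      ∀ g ∈ M, (∀ f ∈ U, Fixed H f → rep G g f = f) → g ∈ H := by
  obtain ⟨x, hx, hxfix, hx₀⟩ := hX.exists_fixed
  obtain ⟨U, hUI, hU, hirr, hmoved⟩ := exists_irreducible_moved (hHM.trans hML) a _
    (invariant_induced M L X)
    ⟨x, le_induced hML hX.support hX.invariant hx, hxfix,
      rep_ne_of_support (hX.support x hx) hx₀ ha⟩
  refine ⟨U, fun f hf => (hUI hf).1, hU, hirr, hmoved, fun g hg hgfix => ?_⟩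
  have hU₀ : U ≠ ⊥ := by
    rintro rfl
    obtain ⟨u, hu, -, hne⟩ := hmoved
    rw [(Submodule.mem_bot ℂ).1 hu, map_zero] at hne
    exact hne rfl
  refine hX.stabilizer g hg fun f hf hffix => ?_
  obtain ⟨u, hu, hufix, rfl⟩ := exists_fixed_lift hHM hML hX.irreducible hUI hU hU₀ hf hffix
  rw [← restrict_rep hg, hgfix u hu hufix]

/-- The pointwise stabilizer in `L` of the `H`-fixed vectors of `U`. -/
noncomputable def fixer (H L : Subgroup G) (U : Submodule ℂ (EuclideanSpace ℂ G)) :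
    Subgroup G where
  carrier := {g | g ∈ L ∧ ∀ f ∈ U, Fixed H f → rep G g f = f}
  one_mem' := ⟨one_mem _, by simp⟩
  mul_mem' hg hh := ⟨mul_mem hg.1 hh.1, fun f hf hfix => by
    rw [map_mul, Module.End.mul_apply, hh.2 f hf hfix, hg.2 f hf hfix]⟩
  inv_mem' {g} hg := ⟨inv_mem hg.1, fun f hf hfix => by
    conv_lhs => rw [← hg.2 f hf hfix]
    simp⟩

theorem le_fixer {H L : Subgroup G} (hHL : H ≤ L) (U : Submodule ℂ (EuclideanSpace ℂ G)) :
    H ≤ fixer H L U :=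
  fun g hg => ⟨hHL hg, fun _ _ hfix => hfix g hg⟩

/-- The space of functions supported on `H` and constant there is linearly primitive. -/
theorem exists_linearlyPrimitive_self (H : Subgroup G) :
    ∃ X : Submodule ℂ (EuclideanSpace ℂ G), LinearlyPrimitive H H X := by
  set e : EuclideanSpace ℂ G := restrict H (WithLp.toLp 2 fun _ => 1) with he
  have hfix : Fixed H e := fun g hg => by
    rw [he, ← restrict_rep hg]
    rfl
  have he₀ : e ≠ 0 := fun h => by
    have := congrArg (fun k : EuclideanSpace ℂ G => k 1) h
    simp [he, one_mem] at this
  refine ⟨ℂ ∙ e, ?_, ?_, ?_, ⟨e, Submodule.mem_span_singleton_self e, hfix, he₀⟩,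
    fun g hg _ => hg⟩
  · intro f hf x hx
    obtain ⟨c, rfl⟩ := Submodule.mem_span_singleton.1 hf
    simp [he, hx]
  · intro g hg f hf
    obtain ⟨c, rfl⟩ := Submodule.mem_span_singleton.1 hf
    rw [map_smul, hfix g hg]
    exact hf
  · intro W hW _
    exact ((nonzero_span_atom e he₀).le_iff.1 hW)

theorem exists_linearlyPrimitive_of_distrib {H b : Subgroup G}
    (hdistrib : ∀ K₁ K₂ K₃ : Subgroup G, H ≤ K₁ → K₁ ≤ b → H ≤ K₂ → K₂ ≤ b →
      H ≤ K₃ → K₃ ≤ b → K₁ ⊓ (K₂ ⊔ K₃) = (K₁ ⊓ K₂) ⊔ (K₁ ⊓ K₃))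
    (L : Subgroup G) (hHL : H ≤ L) (hLb : L ≤ b) :
    ∃ X : Submodule ℂ (EuclideanSpace ℂ G), LinearlyPrimitive H L X := by
  induction L using WellFoundedLT.induction with
  | ind L ih =>
  rcases hHL.eq_or_lt with rfl | hlt
  · exact exists_linearlyPrimitive_self H
  obtain ⟨M, ⟨hHM, hML⟩, hmax⟩ :=
    (Set.toFinite {M : Subgroup G | H ≤ M ∧ M < L}).exists_maximal ⟨H, le_rfl, hlt⟩
  obtain ⟨X, hX⟩ := ih M hML hHM (hML.le.trans hLb)
  have hsup : ∀ K : Subgroup G, K ≤ L → ¬ K ≤ M → K ⊔ M = L := by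
    intro K hKL hKM
    by_contra h
    exact hKM (le_sup_left.trans
      (hmax ⟨hHM.trans le_sup_right, lt_of_le_of_ne (sup_le hKL hML.le) h⟩ le_sup_right))
  have hle : ∀ K₁ K₂ : Subgroup G, H ≤ K₁ → K₁ ≤ L → H ≤ K₂ → K₂ ≤ L → K₁ ⊓ M = H →
      ¬ K₂ ≤ M → K₁ ≤ K₂ := by
    intro K₁ K₂ h₁ h₁L h₂ h₂L h₁M h₂M
    have := hdistrib K₁ K₂ M h₁ (h₁L.trans hLb) h₂ (h₂L.trans hLb) hHM (hML.le.trans hLb)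
    rw [hsup K₂ h₂L h₂M, h₁M, inf_eq_left.2 h₁L, sup_eq_left.2 (le_inf h₁ h₂)] at this
    exact inf_eq_left.1 this.symm
  obtain ⟨a, haL, haM, ha⟩ : ∃ a ∈ L, a ∉ M ∧
      ∀ K : Subgroup G, H ≤ K → K ≤ L → K ⊓ M = H → K ≠ H → a ∈ K := by
    by_cases hA : ∃ A : Subgroup G, H ≤ A ∧ A ≤ L ∧ A ⊓ M = H ∧ A ≠ H
    · obtain ⟨A, hHA, hAL, hAM, hne⟩ := hA
      obtain ⟨a, haA, haM⟩ := SetLike.not_le_iff_exists.1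
        (fun h => hne ((inf_eq_left.2 h).symm.trans hAM) : ¬ A ≤ M)
      exact ⟨a, hAL haA, haM, fun K hHK hKL hKM hKne => hle A K hHA hAL hHK hKL hAM
        (fun h => hKne ((inf_eq_left.2 h).symm.trans hKM)) haA⟩
    · obtain ⟨a, haL, haM⟩ := SetLike.exists_of_lt hML
      exact ⟨a, haL, haM, fun K h₁ h₂ h₃ h₄ => (hA ⟨K, h₁, h₂, h₃, h₄⟩).elim⟩
  obtain ⟨U, hsupp, hU, hirr, ⟨u, hu, hufix, hne⟩, hstab⟩ := hX.exists_extension hHM hML.le haM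
  refine ⟨U, hsupp, hU, hirr, ⟨u, hu, hufix, fun h => hne (by simp [h])⟩, ?_⟩
  have hKM : fixer H L U ⊓ M = H :=
    le_antisymm (fun g hg => hstab g hg.2 hg.1.2) (le_inf (le_fixer hHL U) hHM)
  have hK : fixer H L U = H := by
    by_contra h
    exact hne ((ha _ (le_fixer hHL U) (fun g hg => hg.1) hKM h).2 u hu hufix)
  exact fun g hg hgfix => hK.le ⟨hg, hgfix⟩

theorem exists_linearlyPrimitive_top {H b : Subgroup G}
    (hb : b = H ⊔ sSup {K : Subgroup G | H < K ∧ ∀ K' : Subgroup G, H < K' → K' ≤ K → K' = K})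
    (hdistrib : ∀ K₁ K₂ K₃ : Subgroup G, H ≤ K₁ → K₁ ≤ b → H ≤ K₂ → K₂ ≤ b →
      H ≤ K₃ → K₃ ≤ b → K₁ ⊓ (K₂ ⊔ K₃) = (K₁ ⊓ K₂) ⊔ (K₁ ⊓ K₃)) :
    ∃ X : Submodule ℂ (EuclideanSpace ℂ G), LinearlyPrimitive H ⊤ X := by
  have hHb : H ≤ b := hb ▸ le_sup_left
  obtain ⟨X, hX⟩ := exists_linearlyPrimitive_of_distrib hdistrib b hHb le_rfl
  rcases eq_or_ne b ⊤ with rfl | hbt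
  · exact ⟨X, hX⟩
  obtain ⟨a, -, hab⟩ := SetLike.exists_of_lt (lt_top_iff_ne_top.2 hbt)
  obtain ⟨U, hsupp, hU, hirr, ⟨u, hu, hufix, hne⟩, hstab⟩ := hX.exists_extension hHb le_top hab
  refine ⟨U, hsupp, hU, hirr, ⟨u, hu, hufix, fun h => hne (by simp [h])⟩, ?_⟩
  have hK : fixer H ⊤ U = H := by
    by_contra h
    obtain ⟨A, hAK, ⟨hHA, hmin⟩⟩ :=
      (Set.toFinite {K : Subgroup G | H < K}).exists_le_minimal
        (lt_of_le_of_ne (le_fixer le_top U) (Ne.symm h))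
    have hAb : A ≤ b := hb ▸ le_sup_of_le_right
      (le_sSup ⟨hHA, fun K' hK' hle => le_antisymm hle (hmin hK' hle)⟩)
    have hAH : ¬ A ≤ H := not_le_of_gt hHA
    exact hAH fun g hg => hstab g (hAb hg) (hAK hg).2
  exact fun g hg hgfix => hK.le ⟨hg, hgfix⟩

end LeftTranslation

/-- If the interval `[H,G]` is bottom Boolean, i.e. the interval `[H,b]` is a Boolean
lattice where `b` is the join of the atoms of `[H,G]` (it is bounded, and we assume it is
distributive and complemented), then there exists an irreducible complex representation
`(V, ρ)` of `G` whose fixed-point subspace `V^H` has pointwise stabilizer exactly `H`. -/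
theorem stmt9 {G : Type*} [Group G] [Finite G] (H b : Subgroup G)
    (hb : b = H ⊔ sSup {K : Subgroup G | H < K ∧ ∀ K' : Subgroup G, H < K' → K' ≤ K → K' = K})
    (hdistrib : ∀ K₁ K₂ K₃ : Subgroup G, H ≤ K₁ → K₁ ≤ b → H ≤ K₂ → K₂ ≤ b →
      H ≤ K₃ → K₃ ≤ b → K₁ ⊓ (K₂ ⊔ K₃) = (K₁ ⊓ K₂) ⊔ (K₁ ⊓ K₃))
    (hcompl : ∀ K : Subgroup G, H ≤ K → K ≤ b →
      ∃ K' : Subgroup G, H ≤ K' ∧ K' ≤ b ∧ K ⊓ K' = H ∧ K ⊔ K' = b) :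
    ∃ (V : Type) (_ : AddCommGroup V) (_ : Module ℂ V) (_ : FiniteDimensional ℂ V)
      (ρ : Representation ℂ G V),
      Nontrivial V ∧
      (∀ W : Submodule ℂ V, (∀ g : G, ∀ v ∈ W, ρ g v ∈ W) → W = ⊥ ∨ W = ⊤) ∧
      (∀ g : G, (∀ v : V, (∀ h ∈ H, ρ h v = v) → ρ g v = v) ↔ g ∈ H) := by
  have := Fintype.ofFinite G
  obtain ⟨X, hX⟩ := LeftTranslation.exists_linearlyPrimitive_top hb hdistrib
  have hinv : ∀ g : G, ∀ f ∈ X, LeftTranslation.rep G g f ∈ X :=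
    fun g => hX.invariant g (Subgroup.mem_top g)
  set e : X ≃ₗ[ℂ] (Fin (Module.finrank ℂ X) → ℂ) := (Module.finBasis ℂ X).equivFun
  let σ : Representation ℂ G X :=
    { toFun := fun g => (LeftTranslation.rep G g).restrict (hinv g)
      map_one' := by ext; simp
      map_mul' := fun g h => by ext; simp }
  let ρ : Representation ℂ G (Fin (Module.finrank ℂ X) → ℂ) :=
    { toFun := fun g => e.conj (σ g)
      map_one' := by ext; simp [LinearEquiv.conj_apply_apply]
      map_mul' := fun g h => by ext; simp [LinearEquiv.conj_apply_apply] }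
  have hρ : ∀ g x, ρ g (e x) = e (σ g x) := fun g x => by simp [ρ, LinearEquiv.conj_apply_apply]
  have hσ : ∀ g (x : X), (σ g x : EuclideanSpace ℂ G) = LeftTranslation.rep G g x :=
    fun _ _ => rfl
  refine ⟨Fin (Module.finrank ℂ X) → ℂ, inferInstance, inferInstance, inferInstance, ρ, ?_, ?_, ?_⟩
  · obtain ⟨f, hf, -, hf₀⟩ := hX.exists_fixed
    have : Nontrivial X := ⟨⟨f, hf⟩, 0, fun h => hf₀ (congrArg Subtype.val h)⟩
    exact e.symm.toEquiv.nontrivial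
  · intro W hW
    have hW' : LeftTranslation.Invariant ⊤ ((W.comap e.toLinearMap).map X.subtype) := by
      rintro g - _ ⟨x, hx, rfl⟩
      refine ⟨σ g x, ?_, rfl⟩
      simpa [hρ] using hW g _ hx
    rcases hX.irreducible _ (Submodule.map_subtype_le _ _) hW' with h | h
    · left
      rw [← Submodule.map_bot X.subtype] at h
      replace h := Submodule.map_injective_of_injective X.injective_subtype h
      rw [eq_bot_iff]
      intro v hv
      have : e.symm v ∈ W.comap e.toLinearMap := by simpa using hv
      rw [h, Submodule.mem_bot] at this
      simpa using this
    · right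
      rw [eq_top_iff]
      intro v _
      have : (e.symm v : EuclideanSpace ℂ G) ∈ (W.comap e.toLinearMap).map X.subtype := by
        rw [h]
        exact (e.symm v).2
      obtain ⟨x, hx, hxv⟩ := this
      rw [Subtype.ext hxv] at hx
      simpa using hx
  · refine fun g => ⟨fun hg => ?_, fun hg v hv => hv g hg⟩
    refine hX.stabilizer g (Subgroup.mem_top g) fun f hf hfix => ?_
    have := hg (e ⟨f, hf⟩) fun h hh => by
      rw [hρ]
      exact congrArg e (Subtype.ext (hfix h hh))
    rw [hρ] at this
    exact congrArg Subtype.val (e.injective this)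
end

section
/- (Dual Ore theorem) Let G be a finite group and H a subgroup of G such that the interval [H,G] is a distributive lattice. Then there exists an irreducible complex representation V of G such that the pointwise stabilizer of the fixed-point subspace V^H equals H, i.e. G₍V^H₎ = H. -/
namespace Representation

section General

variable {k G V : Type*} [Field k] [Group G] [AddCommGroup V] [Module k V]

/-- The pointwise stabilizer of the subspace of vectors fixed by a subgroup `H`. -/
def fixedStabilizer (ρ : Representation k G V) (H : Subgroup G) : Subgroup G where
  carrier := {g | ∀ v : V, (∀ h ∈ H, ρ h v = v) → ρ g v = v}
  one_mem' := by simp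
  mul_mem' := by
    intro a b ha hb v hv
    rw [map_mul, Module.End.mul_apply, hb v hv, ha v hv]
  inv_mem' := by
    intro a ha v hv
    conv_lhs => rw [← ha v hv]
    exact ρ.inv_self_apply a v

theorem mem_fixedStabilizer {ρ : Representation k G V} {H : Subgroup G} {g : G} :
    g ∈ ρ.fixedStabilizer H ↔ ∀ v : V, (∀ h ∈ H, ρ h v = v) → ρ g v = v :=
  Iff.rfl

theorem le_fixedStabilizer (ρ : Representation k G V) (H : Subgroup G) :
    H ≤ ρ.fixedStabilizer H :=
  fun g hg _ hv => hv g hg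

theorem exists_isCoatom_notMem (ρ : Representation k G V) [IsSemisimpleRepresentation ρ]
    {y : V} (hy : y ≠ 0) : ∃ N : Subrepresentation ρ, IsCoatom N ∧ y ∉ N := by
  have : IsSemisimpleModule (MonoidAlgebra k G) ρ.asModule :=
    (isSemisimpleRepresentation_iff_isSemisimpleModule_asModule ρ).1 inferInstance
  have hjac := IsSemisimpleModule.jacobson_eq_bot (MonoidAlgebra k G) ρ.asModule
  by_contra! hcon
  let z : ρ.asModule := ρ.asModuleEquiv.symm y
  have hmem : z ∈ Module.jacobson (MonoidAlgebra k G) ρ.asModule := by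
    refine Submodule.mem_sInf.2 fun m hm => ?_
    exact hcon (Subrepresentation.subrepresentationSubmoduleOrderIso.symm m)
      ((OrderIso.isCoatom_iff _ _).2 hm)
  rw [hjac] at hmem
  exact hy hmem

theorem isIrreducible_quotient {ρ : Representation k G V} {N : Subrepresentation ρ}
    (hN : IsCoatom N) :
    IsIrreducible (ρ.quotient N.toSubmodule fun g _ hv => N.apply_mem_toSubmodule g hv) := by
  have hne : N.toSubmodule ≠ ⊤ := fun h =>
    hN.1 (Subrepresentation.toSubmodule_injective h)
  have hnt : (⊥ : Subrepresentation
      (ρ.quotient N.toSubmodule fun g _ hv => N.apply_mem_toSubmodule g hv)) ≠ ⊤ := by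
    intro h
    have h' : (⊥ : Submodule k (V ⧸ N.toSubmodule)) = ⊤ :=
      congrArg Subrepresentation.toSubmodule h
    have := Submodule.Quotient.nontrivial_iff.2 hne
    exact bot_ne_top h'
  refine { exists_pair_ne := ⟨_, _, hnt⟩, eq_bot_or_eq_top := fun P => ?_ }
  let Q : Subrepresentation ρ :=
    ⟨P.toSubmodule.comap N.toSubmodule.mkQ, fun g v hv => P.apply_mem_toSubmodule g hv⟩
  have hNQ : N ≤ Q := fun v hv => by
    change N.toSubmodule.mkQ v ∈ P.toSubmodule
    rw [Submodule.mkQ_apply, (Submodule.Quotient.mk_eq_zero _).2 hv]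
    exact P.toSubmodule.zero_mem
  rcases hN.le_iff.1 hNQ with h | h
  · right
    apply Subrepresentation.toSubmodule_injective
    refine (Submodule.eq_top_iff' (p := P.toSubmodule)).2 fun w => ?_
    obtain ⟨v, rfl⟩ := N.toSubmodule.mkQ_surjective w
    have : v ∈ Q := h ▸ (Submodule.mem_top : v ∈ (⊤ : Submodule k V))
    exact this
  · left
    apply Subrepresentation.toSubmodule_injective
    refine (Submodule.eq_bot_iff P.toSubmodule).2 fun w hw => ?_
    obtain ⟨v, rfl⟩ := N.toSubmodule.mkQ_surjective w
    have : v ∈ Q := hw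
    rw [h] at this
    exact (Submodule.Quotient.mk_eq_zero _).2 this

/-- The right regular action of `G` on functions `ι → V`, where `ι` is a relabelling of `G`. -/
def rightTranslation {ι : Type*} (e : G ≃ ι) : Representation k G (ι → V) where
  toFun g := LinearMap.funLeft k V fun i => e (e.symm i * g)
  map_one' := by ext; simp [LinearMap.funLeft]
  map_mul' a b := by
    apply LinearMap.ext
    intro f
    funext i
    simp [LinearMap.funLeft_apply, mul_assoc]

@[simp]
theorem rightTranslation_apply {ι : Type*} (e : G ≃ ι) (g : G) (f : ι → V) (i : ι) :
    rightTranslation (k := k) e g f i = f (e (e.symm i * g)) :=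
  rfl

open Classical in
/-- Extension by zero of an orbit map: an `L`-equivariant map from `V` to `V`-valued functions
on `G`. -/
noncomputable def extendOrbit {ι : Type*} (e : G ≃ ι) {L : Subgroup G}
    (σ : Representation k L V) : V →ₗ[k] (ι → V) where
  toFun x i := if h : e.symm i ∈ L then σ ⟨e.symm i, h⟩ x else 0
  map_add' x y := by
    funext i
    by_cases h : e.symm i ∈ L <;> simp [h]
  map_smul' c x := by
    funext i
    by_cases h : e.symm i ∈ L <;> simp [h]

theorem extendOrbit_of_mem {ι : Type*} (e : G ≃ ι) {L : Subgroup G}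
    (σ : Representation k L V) (x : V) {g : G} (hg : g ∈ L) :
    extendOrbit e σ x (e g) = σ ⟨g, hg⟩ x := by
  simp [extendOrbit, hg]

theorem extendOrbit_of_notMem {ι : Type*} (e : G ≃ ι) {L : Subgroup G}
    (σ : Representation k L V) (x : V) {g : G} (hg : g ∉ L) : extendOrbit e σ x (e g) = 0 := by
  simp [extendOrbit, hg]

theorem extendOrbit_one {ι : Type*} (e : G ≃ ι) {L : Subgroup G}
    (σ : Representation k L V) (x : V) : extendOrbit e σ x (e 1) = x := by
  rw [extendOrbit_of_mem e σ x L.one_mem]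
  exact LinearMap.congr_fun (map_one σ) x

theorem extendOrbit_equivariant {ι : Type*} (e : G ≃ ι) {L : Subgroup G}
    (σ : Representation k L V) (l : L) (x : V) :
    extendOrbit e σ (σ l x) = rightTranslation (k := k) e (l : G) (extendOrbit e σ x) := by
  funext i
  obtain ⟨g, rfl⟩ := e.surjective i
  rw [rightTranslation_apply, _root_.Equiv.symm_apply_apply]
  by_cases h : g ∈ L
  · rw [extendOrbit_of_mem e σ _ h, extendOrbit_of_mem e σ _ (L.mul_mem h l.2),
      ← Module.End.mul_apply, ← map_mul]
    rfl
  · rw [extendOrbit_of_notMem e σ _ h,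
      extendOrbit_of_notMem e σ _ fun hc => h ((L.mul_mem_cancel_right l.2).1 hc)]

end General

/-- An irreducible representation of a subgroup `L` with a nonzero `H`-fixed vector embeds in an
irreducible representation of `G` in which a prescribed element outside `L` moves some `H`-fixed
vector. -/
theorem exists_isIrreducible_notMem_fixedStabilizer {G : Type*} [Group G] [Finite G]
    {H L : Subgroup G} (hHL : H ≤ L) {X : Type} [AddCommGroup X] [Module ℂ X]
    [FiniteDimensional ℂ X] (σ : Representation ℂ L X) [IsIrreducible σ]
    (hσ : σ.fixedStabilizer (H.subgroupOf L) = H.subgroupOf L)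
    {x : X} (hx : x ≠ 0) (hxH : ∀ h ∈ H.subgroupOf L, σ h x = x) {g : G} (hg : g ∉ L) :
    ∃ (V : Type) (_ : AddCommGroup V) (_ : Module ℂ V) (_ : FiniteDimensional ℂ V)
      (ρ : Representation ℂ G V), IsIrreducible ρ ∧ ρ.fixedStabilizer H ⊓ L = H ∧
        g ∉ ρ.fixedStabilizer H := by
  let e := Finite.equivFin G
  let τ : Representation ℂ G (Fin (Nat.card G) → X) := rightTranslation e
  have hy : τ g (extendOrbit e σ x) - extendOrbit e σ x ≠ 0 := by
    intro h
    have h1 := congrFun h (e 1)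
    rw [Pi.sub_apply, rightTranslation_apply, _root_.Equiv.symm_apply_apply, one_mul,
      extendOrbit_of_notMem e σ x hg, extendOrbit_one, zero_sub] at h1
    exact hx (neg_eq_zero.1 h1)
  have : NeZero (Nat.card G : ℂ) := ⟨Nat.cast_ne_zero.2 Nat.card_pos.ne'⟩
  obtain ⟨N, hN, hyN⟩ := exists_isCoatom_notMem τ hy
  let ρ := τ.quotient N.toSubmodule fun g _ hv => N.apply_mem_toSubmodule g hv
  let φ : X →ₗ[ℂ] _ := N.toSubmodule.mkQ ∘ₗ extendOrbit e σ
  have hφ (l : L) (v : X) : φ (σ l v) = ρ (l : G) (φ v) :=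
    congrArg N.toSubmodule.mkQ (extendOrbit_equivariant e σ l v)
  have hmove : ρ g (φ x) ≠ φ x := by
    intro h
    exact hyN ((Submodule.Quotient.eq N.toSubmodule).1 h)
  let P : Subrepresentation σ := ⟨LinearMap.ker φ, fun l v hv => by
    rw [LinearMap.mem_ker] at hv ⊢
    rw [hφ, hv, map_zero]⟩
  have hinj : Function.Injective φ := by
    rw [← LinearMap.ker_eq_bot]
    rcases eq_bot_or_eq_top P with h | h
    · exact congrArg Subrepresentation.toSubmodule h
    · have hxP : x ∈ P := h ▸ (Submodule.mem_top : x ∈ (⊤ : Submodule ℂ X))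
      have h0 : φ x = 0 := hxP
      exact absurd (by rw [h0, map_zero]) hmove
  have hfix {v : X} (hv : ∀ h ∈ H.subgroupOf L, σ h v = v) : ∀ h ∈ H, ρ h (φ v) = φ v := by
    intro h hh
    rw [← hφ ⟨h, hHL hh⟩ v, hv ⟨h, hHL hh⟩ hh]
  refine ⟨_, inferInstance, inferInstance, inferInstance, ρ, isIrreducible_quotient hN,
    le_antisymm ?_ (le_inf (le_fixedStabilizer ρ H) hHL), fun h => hmove (h _ (hfix hxH))⟩
  rintro a ⟨ha, haL⟩
  have : (⟨a, haL⟩ : L) ∈ σ.fixedStabilizer (H.subgroupOf L) := fun v hv =>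
    hinj (by rw [hφ]; exact ha _ (hfix hv))
  rw [hσ] at this
  exact this

end Representation

/-- In a distributive interval `[H, G]` with `H ≠ G` there are an atom `K` and a proper subgroup
`L` such that only `H` meets both trivially. -/
theorem Subgroup.exists_atom_pseudocomplement {G : Type*} [Group G] [Finite G] {H : Subgroup G}
    (hdistrib : ∀ K₁ K₂ K₃ : Subgroup G, H ≤ K₁ → H ≤ K₂ → H ≤ K₃ →
      K₁ ⊓ (K₂ ⊔ K₃) = (K₁ ⊓ K₂) ⊔ (K₁ ⊓ K₃)) (hH : H ≠ ⊤) :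
    ∃ K L : Subgroup G, H ≤ L ∧ ¬K ≤ L ∧ (∀ A, H ≤ A → ¬K ≤ A → A ⊓ L = H → A = H) := by
  obtain ⟨K, hHK, -⟩ := exists_covBy_le_of_lt (lt_top_iff_ne_top.2 hH)
  have hatom (A : Subgroup G) (hA : H ≤ A) (hKA : ¬K ≤ A) : K ⊓ A = H := by
    rcases hHK.eq_or_eq (le_inf hHK.le hA) inf_le_left with h | h
    · exact h
    · exact absurd (inf_eq_left.1 h) hKA
  obtain ⟨L, hL⟩ := (Set.toFinite {L : Subgroup G | H ≤ L ∧ ¬K ≤ L}).exists_maximal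
    ⟨H, le_rfl, hHK.lt.not_ge⟩
  refine ⟨K, L, hL.prop.1, hL.prop.2, fun A hA hKA hAL => ?_⟩
  have hsup : K ⊓ (L ⊔ A) = H := by
    rw [hdistrib K L A hHK.le hL.prop.1 hA, hatom L hL.prop.1 hL.prop.2, hatom A hA hKA, sup_idem]
  have hle : L ⊔ A ≤ L := hL.le_of_ge
    ⟨hA.trans le_sup_right, fun h => hHK.lt.not_ge (by rw [← hsup, inf_eq_left.2 h])⟩
    le_sup_left
  rw [← hAL, inf_eq_left.2 (le_sup_right.trans hle)]

open Representation in
theorem Subgroup.exists_isIrreducible_fixedStabilizer_eq {G : Type*} [Group G] [Finite G]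
    (H : Subgroup G)
    (hdistrib : ∀ K₁ K₂ K₃ : Subgroup G, H ≤ K₁ → H ≤ K₂ → H ≤ K₃ →
      K₁ ⊓ (K₂ ⊔ K₃) = (K₁ ⊓ K₂) ⊔ (K₁ ⊓ K₃)) :
    ∃ (V : Type) (_ : AddCommGroup V) (_ : Module ℂ V) (_ : FiniteDimensional ℂ V)
      (ρ : Representation ℂ G V), IsIrreducible ρ ∧ ρ.fixedStabilizer H = H ∧
        ∃ v : V, v ≠ 0 ∧ ∀ h ∈ H, ρ h v = v := by
  induction hn : Nat.card G using Nat.strong_induction_on generalizing G with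
  | _ n ih =>
  by_cases hH : H = ⊤
  · subst hH
    refine ⟨ℂ, inferInstance, inferInstance, inferInstance, Representation.trivial ℂ G ℂ, ?_,
      top_le_iff.1 (le_fixedStabilizer _ _), 1, one_ne_zero, fun _ _ => rfl⟩
    have hne : (⊥ : Subrepresentation (Representation.trivial ℂ G ℂ)) ≠ ⊤ := fun h =>
      bot_ne_top (α := Submodule ℂ ℂ) (congrArg Subrepresentation.toSubmodule h)
    exact
      { exists_pair_ne := ⟨_, _, hne⟩
        eq_bot_or_eq_top := fun P => (eq_bot_or_eq_top P.toSubmodule).imp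
          (fun h => Subrepresentation.toSubmodule_injective h)
          (fun h => Subrepresentation.toSubmodule_injective h) }
  obtain ⟨K, L, hHL, hKL, hpc⟩ := exists_atom_pseudocomplement hdistrib hH
  have hLtop : L ≠ ⊤ := fun h => hKL (h ▸ le_top)
  have hcard : Nat.card L < n := hn ▸ lt_of_le_of_ne L.card_le_card_group
    fun h => hLtop (L.eq_top_of_card_eq h)
  have hdist : ∀ K₁ K₂ K₃ : Subgroup L, H.subgroupOf L ≤ K₁ → H.subgroupOf L ≤ K₂ →
      H.subgroupOf L ≤ K₃ → K₁ ⊓ (K₂ ⊔ K₃) = (K₁ ⊓ K₂) ⊔ (K₁ ⊓ K₃) := by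
    intro K₁ K₂ K₃ h₁ h₂ h₃
    have hle {A : Subgroup L} (hA : H.subgroupOf L ≤ A) : H ≤ A.map L.subtype := by
      intro h hh
      exact ⟨⟨h, hHL hh⟩, hA hh, rfl⟩
    apply Subgroup.map_injective L.subtype_injective
    simp only [Subgroup.map_inf _ _ _ L.subtype_injective, Subgroup.map_sup]
    exact hdistrib _ _ _ (hle h₁) (hle h₂) (hle h₃)
  obtain ⟨X, _, _, _, σ, _, hσ, x, hx, hxH⟩ := ih _ hcard (H.subgroupOf L) hdist rfl
  obtain ⟨g, hgK, hgL⟩ := SetLike.not_le_iff_exists.1 hKL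
  obtain ⟨V, _, _, _, ρ, hρ, hρL, hρg⟩ :=
    exists_isIrreducible_notMem_fixedStabilizer hHL σ hσ hx hxH hgL
  refine ⟨V, _, _, inferInstance, ρ, hρ,
    hpc _ (le_fixedStabilizer ρ H) (fun h => hρg (h hgK)) hρL, ?_⟩
  rw [mem_fixedStabilizer] at hρg
  push Not at hρg
  obtain ⟨v, hv, hvg⟩ := hρg
  exact ⟨v, fun h => hvg (by rw [h, map_zero]), hv⟩

/-- (Dual Ore theorem) If the interval `[H,G]` of intermediate subgroups of a finite group
`G` is a distributive lattice, then there exists an irreducible complex representation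
`(V, ρ)` of `G` whose fixed-point subspace `V^H` has pointwise stabilizer exactly `H`. -/
theorem stmt10 {G : Type*} [Group G] [Finite G] (H : Subgroup G)
    (hdistrib : ∀ K₁ K₂ K₃ : Subgroup G, H ≤ K₁ → H ≤ K₂ → H ≤ K₃ →
      K₁ ⊓ (K₂ ⊔ K₃) = (K₁ ⊓ K₂) ⊔ (K₁ ⊓ K₃)) :
    ∃ (V : Type) (_ : AddCommGroup V) (_ : Module ℂ V) (_ : FiniteDimensional ℂ V)
      (ρ : Representation ℂ G V),
      Nontrivial V ∧
      (∀ W : Submodule ℂ V, (∀ g : G, ∀ v ∈ W, ρ g v ∈ W) → W = ⊥ ∨ W = ⊤) ∧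
      (∀ g : G, (∀ v : V, (∀ h ∈ H, ρ h v = v) → ρ g v = v) ↔ g ∈ H) := by
  obtain ⟨V, _, _, _, ρ, hρ, hstab, v, hv, -⟩ :=
    H.exists_isIrreducible_fixedStabilizer_eq hdistrib
  refine ⟨V, _, _, inferInstance, ρ, ⟨v, 0, hv⟩, fun W hW => ?_, fun g => ?_⟩
  · exact (hρ.eq_bot_or_eq_top ⟨W, hW⟩).imp
      (congrArg Subrepresentation.toSubmodule) (congrArg Subrepresentation.toSubmodule)
  · rw [← Representation.mem_fixedStabilizer, hstab]
end

section
/- Let G be a finite group and suppose there exists a chain of subgroups {e} = H₀ < H₁ < ⋯ < H_ℓ = G such that each interval [Hᵢ, Hᵢ₊₁] is bottom Boolean. Then there exist irreducible complex representations V₁, …, V_ℓ of G whose direct sum V₁ ⊕ ⋯ ⊕ V_ℓ is a faithful representation of G; equivalently, G admits a faithful complex representation with at most ℓ irreducible components. -/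
/-- The interval `[A,B]` of intermediate subgroups is bottom Boolean: letting `b` be the
join of the atoms of `[A,B]`, the interval `[A,b]` is a Boolean lattice, i.e. (being
bounded by `A` and `b`) it is distributive and complemented. -/
def IntervalBottomBoolean {G : Type*} [Group G] (A B : Subgroup G) : Prop :=
  ∀ b : Subgroup G,
    b = A ⊔ sSup {K : Subgroup G | A < K ∧ K ≤ B ∧
        ∀ K' : Subgroup G, A < K' → K' ≤ K → K' = K} →
    (∀ K₁ K₂ K₃ : Subgroup G, A ≤ K₁ → K₁ ≤ b → A ≤ K₂ → K₂ ≤ b → A ≤ K₃ → K₃ ≤ b →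
      K₁ ⊓ (K₂ ⊔ K₃) = (K₁ ⊓ K₂) ⊔ (K₁ ⊓ K₃)) ∧
    (∀ K : Subgroup G, A ≤ K → K ≤ b →
      ∃ K' : Subgroup G, A ≤ K' ∧ K' ≤ b ∧ K ⊓ K' = A ∧ K ⊔ K' = b)

/-- Over a finite group, every nonzero element of the complex group algebra acts nontrivially on
some irreducible representation. -/
theorem exists_irreducible_asAlgebraHom_ne_zero {G : Type*} [Group G] [Finite G]
    {x : MonoidAlgebra ℂ G} (hx : x ≠ 0) :
    ∃ (n : ℕ) (ρ : Representation ℂ G (Fin n → ℂ)), Nontrivial (Fin n → ℂ) ∧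
      (∀ W : Submodule ℂ (Fin n → ℂ), (∀ g : G, ∀ v ∈ W, ρ g v ∈ W) → W = ⊥ ∨ W = ⊤) ∧
      ρ.asAlgebraHom x ≠ 0 := by
  have : NeZero (Nat.card G : ℂ) := ⟨by exact_mod_cast Nat.card_pos.ne'⟩
  obtain ⟨S, hS, s, hs, hxs⟩ : ∃ S : Submodule (MonoidAlgebra ℂ G) (MonoidAlgebra ℂ G),
      IsSimpleModule (MonoidAlgebra ℂ G) S ∧ ∃ s ∈ S, x * s ≠ 0 := by
    by_contra! h
    apply hx
    have h1 : (1 : MonoidAlgebra ℂ G) ∈ sSup {m : Submodule (MonoidAlgebra ℂ G)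
        (MonoidAlgebra ℂ G) | IsSimpleModule (MonoidAlgebra ℂ G) m} := by
      rw [IsSemisimpleModule.sSup_simples_eq_top]; trivial
    rw [sSup_eq_iSup'] at h1
    have h2 : x * 1 = 0 := Submodule.iSup_induction _ (motive := fun m => x * m = 0) h1
      (fun S m hm => h S.1 S.2 m hm) (mul_zero x)
      (fun a b ha hb => by rw [mul_add, ha, hb, add_zero])
    simpa using h2
  have : Module.Finite ℂ (MonoidAlgebra ℂ G) :=
    Module.Finite.equiv (MonoidAlgebra.coeffLinearEquiv ℂ (M := G) (S := ℂ)).symm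
  have : Module.Finite ℂ S := Module.Finite.of_injective
    (S.subtype.restrictScalars ℂ) S.injective_subtype
  let e : S ≃ₗ[ℂ] (Fin (Module.finrank ℂ S) → ℂ) := (Module.finBasis ℂ S).equivFun
  let φ : MonoidAlgebra ℂ G →ₐ[ℂ] Module.End ℂ (Fin (Module.finrank ℂ S) → ℂ) :=
    (e.conjAlgEquiv ℂ).toAlgHom.comp (Algebra.lsmul ℂ ℂ S)
  let ρ : Representation ℂ G (Fin (Module.finrank ℂ S) → ℂ) :=
    φ.toRingHom.toMonoidHom.comp (MonoidAlgebra.of ℂ G)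
  have hρ : ρ.asAlgebraHom = φ := 
    (MonoidAlgebra.lift ℂ _ G).apply_symm_apply φ
  have hφ : ∀ y s, φ y (e s) = e (y • s) := fun y s => by
    simp [φ, LinearEquiv.conjAlgEquiv_apply]
  have := IsSimpleModule.nontrivial (MonoidAlgebra ℂ G) S
  refine ⟨_, ρ, e.symm.toEquiv.nontrivial, fun W hW => ?_, fun h => hxs ?_⟩
  · have hW' : ∀ y : MonoidAlgebra ℂ G, ∀ v ∈ W, φ y v ∈ W := by
      intro y v hv
      induction y using MonoidAlgebra.induction_on with
      | of g => exact hW g v hv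
      | add a b ha hb => rw [map_add]; exact W.add_mem ha hb
      | smul r a ha => rw [map_smul]; exact W.smul_mem r ha
    let T : Submodule (MonoidAlgebra ℂ G) S :=
      { carrier := {s | e s ∈ W}
        add_mem' := fun {a b} ha hb => by
          simp only [Set.mem_ofPred_eq, map_add] at *
          exact W.add_mem ha hb
        zero_mem' := by simp
        smul_mem' := fun y s hs => by
          simp only [Set.mem_ofPred_eq, ← hφ] at *
          exact hW' y _ hs }
    have hT : ∀ s, s ∈ T ↔ e s ∈ W := fun s => Iff.rfl
    rcases eq_bot_or_eq_top T with h | h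
    · left
      rw [Submodule.eq_bot_iff]
      intro v hv
      have : e.symm v ∈ T := by rw [hT]; simpa
      rw [h, Submodule.mem_bot] at this
      simpa using this
    · right
      rw [Submodule.eq_top_iff']
      intro v
      have : e.symm v ∈ T := by rw [h]; trivial
      rw [hT] at this
      simpa using this
  · rw [hρ] at h
    have h1 := hφ x ⟨s, hs⟩
    rw [h, LinearMap.zero_apply, eq_comm, map_eq_zero_iff _ e.injective] at h1
    simpa using congrArg Subtype.val h1

namespace Subgroup

variable {G : Type*} [Group G]

/-- The element of the group algebra averaging over a subgroup. -/
noncomputable def avg (B : Subgroup G) : MonoidAlgebra ℂ G :=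
  (Nat.card B : ℂ)⁻¹ • ∑ᶠ b : B, MonoidAlgebra.of ℂ G b

/-- The elements of the group algebra supported in a subgroup. -/
noncomputable def supportedAlg (L : Subgroup G) : Subalgebra ℂ (MonoidAlgebra ℂ G) :=
  (MonoidAlgebra.mapDomainAlgHom ℂ ℂ L.subtype).range

theorem mem_of_mem_supportedAlg {L : Subgroup G} {x : MonoidAlgebra ℂ G}
    (hx : x ∈ L.supportedAlg) {g : G} (hg : x.coeff g ≠ 0) : g ∈ L := by
  obtain ⟨y, rfl⟩ := hx
  by_contra h
  apply hg
  exact Finsupp.mapDomain_of_notMem_range _ _ (by simpa using h)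

theorem of_mem_supportedAlg {L : Subgroup G} {g : G} (hg : g ∈ L) :
    MonoidAlgebra.of ℂ G g ∈ L.supportedAlg :=
  ⟨MonoidAlgebra.of ℂ L ⟨g, hg⟩, by simp⟩

theorem avg_eq (B : Subgroup G) [Fintype B] :
    B.avg = (Nat.card B : ℂ)⁻¹ • ∑ b : B, MonoidAlgebra.of ℂ G b := by
  rw [avg, finsum_eq_sum_of_fintype]

variable [Finite G]

theorem avg_mem_supportedAlg {B L : Subgroup G} (h : B ≤ L) : B.avg ∈ L.supportedAlg := by
  have := Fintype.ofFinite B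
  rw [avg_eq]
  exact Subalgebra.smul_mem _ (Subalgebra.sum_mem _ fun b _ => of_mem_supportedAlg (h b.2)) _

theorem map_avg_mul {A : Type*} [Ring A] [Algebra ℂ A] (φ : MonoidAlgebra ℂ G →ₐ[ℂ] A)
    (B : Subgroup G) (a : A) (h : ∀ b ∈ B, φ (MonoidAlgebra.of ℂ G b) * a = a) :
    φ B.avg * a = a := by
  have := Fintype.ofFinite B
  rw [avg_eq, map_smul, map_sum, smul_mul_assoc, Finset.sum_mul,
    Finset.sum_congr rfl (fun (b : B) _ => h b.1 b.2), Finset.sum_const, Finset.card_univ,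
    ← Nat.cast_smul_eq_nsmul ℂ, smul_smul, Nat.card_eq_fintype_card, inv_mul_cancel₀, one_smul]
  exact_mod_cast Fintype.card_ne_zero

theorem avg_mul_of {B : Subgroup G} {b : G} (hb : b ∈ B) :
    B.avg * MonoidAlgebra.of ℂ G b = B.avg := by
  have := Fintype.ofFinite B
  rw [avg_eq, smul_mul_assoc, Finset.sum_mul]
  congr 1
  exact Fintype.sum_equiv (Equiv.mulRight ⟨b, hb⟩) _ _ fun c => by
    simp [MonoidAlgebra.single_mul_single]

theorem of_mul_avg {B : Subgroup G} {b : G} (hb : b ∈ B) :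
    MonoidAlgebra.of ℂ G b * B.avg = B.avg := by
  have := Fintype.ofFinite B
  rw [avg_eq, mul_smul_comm, Finset.mul_sum]
  congr 1
  exact Fintype.sum_equiv (Equiv.mulLeft ⟨b, hb⟩) _ _ fun c => by
    simp [MonoidAlgebra.single_mul_single]

theorem avg_mul_self (B : Subgroup G) : B.avg * B.avg = B.avg :=
  map_avg_mul (AlgHom.id ℂ (MonoidAlgebra ℂ G)) B B.avg fun _ hb => of_mul_avg hb

theorem avg_ne_zero (B : Subgroup G) : B.avg ≠ 0 := by
  intro h
  have h1 := map_avg_mul (Representation.trivial ℂ G ℂ).asAlgebraHom B 1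
    (by intro b _; rw [Representation.asAlgebraHom_of, mul_one]; ext; simp)
  rw [h, map_zero, zero_mul] at h1
  exact zero_ne_one h1

theorem commute_of_avg {B : Subgroup G} {g : G} (hg : g ∈ normalizer (B : Set G)) :
    Commute (MonoidAlgebra.of ℂ G g) B.avg := by
  have := Fintype.ofFinite B
  have hg' := mem_normalizer_iff.1 hg
  have hg'' := mem_normalizer_iff''.1 hg
  rw [avg_eq, Commute, SemiconjBy, smul_mul_assoc, mul_smul_comm, Finset.mul_sum, Finset.sum_mul]
  congr 1
  refine Fintype.sum_equiv (⟨fun b => ⟨g * b * g⁻¹, (hg' b).1 b.2⟩,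
    fun b => ⟨g⁻¹ * b * g, (hg'' b).1 b.2⟩, fun b => by ext; simp [mul_assoc],
    fun b => by ext; simp [mul_assoc]⟩ : B ≃ B) _ _ fun b => ?_
  simp [MonoidAlgebra.single_mul_single]

theorem commute_avg_avg {A B : Subgroup G} (h : A ≤ normalizer (B : Set G)) :
    Commute A.avg B.avg := by
  have := Fintype.ofFinite A
  rw [avg_eq A]
  exact (Commute.sum_left _ _ _ fun a _ => commute_of_avg (h a.2)).smul_left _

/-- If `x` is supported in `L` and `B` is not contained in `L` then `x` is not `B`-invariant. -/
theorem mul_one_sub_avg_ne_zero {B L : Subgroup G} (hBL : ¬ B ≤ L) {x : MonoidAlgebra ℂ G}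
    (hx : x ≠ 0) (hxL : x ∈ L.supportedAlg) : x * (1 - B.avg) ≠ 0 := by
  intro h
  rw [mul_sub, mul_one, sub_eq_zero] at h
  obtain ⟨b, hb, hbL⟩ := SetLike.not_le_iff_exists.1 hBL
  obtain ⟨g, hg⟩ : ∃ g, x.coeff g ≠ 0 := by
    by_contra! h0
    exact hx (MonoidAlgebra.ext (Finsupp.ext h0))
  have hgL := mem_of_mem_supportedAlg hxL hg
  have h1 : x * MonoidAlgebra.of ℂ G b = x := by
    rw [h, mul_assoc, avg_mul_of hb]
  have h2 : x.coeff (g * b) = x.coeff g := by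
    rw [← h1]
    nth_rw 2 [h1]
    simp [MonoidAlgebra.of_apply]
  exact hbL ((mul_mem_cancel_left hgL).1 (mem_of_mem_supportedAlg hxL (h2 ▸ hg)))

/-- Given a triangular family of pairwise commuting subgroups, a nonzero element of the group
algebra can be multiplied so as to be annihilated by all averages and remain nonzero. -/
theorem exists_mul_avg_eq_zero {ι : Type*} (F : Finset ι) (B L : ι → Subgroup G)
    {x : MonoidAlgebra ℂ G} (hx : x ≠ 0) (hxL : ∀ i ∈ F, x ∈ (L i).supportedAlg)
    (hBL : ∀ i ∈ F, ∀ j ∈ F, j ≠ i → B j ≤ L i) (hB : ∀ i ∈ F, ¬ B i ≤ L i)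
    (hcomm : ∀ i ∈ F, ∀ j ∈ F, Commute (B i).avg (B j).avg) :
    ∃ y, x * y ≠ 0 ∧ (∀ i ∈ F, x * y * (B i).avg = 0) ∧
      (∀ z, (∀ i ∈ F, Commute z (B i).avg) → Commute z y) ∧
      (∀ M : Subgroup G, (∀ i ∈ F, B i ≤ M) → y ∈ M.supportedAlg) := by
  classical
  induction F using Finset.induction_on with
  | empty => exact ⟨1, by simpa, by simp, fun z _ => Commute.one_right z, fun M _ => one_mem _⟩
  | insert a F ha ih =>
    simp only [Finset.forall_mem_insert] at *
    obtain ⟨y, hy0, hy1, hy2, hy3⟩ := ih hxL.2 (fun i hi j hj => (hBL.2 i hi).2 j hj) hB.2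
      (fun i hi j hj => (hcomm.2 i hi).2 j hj)
    have hya : y ∈ (L a).supportedAlg := hy3 _ fun i hi => hBL.1.2 i hi (by rintro rfl; exact ha hi)
    refine ⟨y * (1 - (B a).avg), ?_, ⟨?_, ?_⟩, ?_, ?_⟩
    · rw [← mul_assoc]
      exact mul_one_sub_avg_ne_zero hB.1 hy0 (mul_mem hxL.1 hya)
    · rw [← mul_assoc, mul_assoc, sub_mul, one_mul, avg_mul_self, sub_self, mul_zero]
    · intro i hi
      have h1 : Commute (1 - (B a).avg) (B i).avg := (Commute.one_left _).sub_left (hcomm.1.2 i hi)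
      rw [← mul_assoc, mul_assoc, h1.eq, ← mul_assoc, hy1 i hi, zero_mul]
    · intro z hz
      exact (hy2 z hz.2).mul_right ((Commute.one_right z).sub_right hz.1)
    · intro M hM
      exact mul_mem (hy3 M hM.2) (sub_mem (one_mem _) (avg_mem_supportedAlg hM.1))

end Subgroup

namespace Subgroup

variable {G : Type*} [Group G]

theorem commutator_le_iff_le_comap_centralizer {C : Subgroup G} [C.Normal] {X Y : Subgroup G} :
    ⁅X, Y⁆ ≤ C ↔
      X ≤ (centralizer (Y.map (QuotientGroup.mk' C) : Set (G ⧸ C))).comap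
        (QuotientGroup.mk' C) := by
  rw [← map_le_iff_le_comap, ← commutator_eq_bot_iff_le_centralizer, ← map_commutator,
    map_eq_bot_iff, QuotientGroup.ker_mk']

theorem sSup_commutator_le {C : Subgroup G} [C.Normal] {S : Set (Subgroup G)} {Y : Subgroup G}
    (h : ∀ X ∈ S, ⁅X, Y⁆ ≤ C) : ⁅sSup S, Y⁆ ≤ C :=
  commutator_le_iff_le_comap_centralizer.2 <| sSup_le fun X hX =>
    commutator_le_iff_le_comap_centralizer.1 (h X hX)

theorem le_normalizer_inf {H A K : Subgroup G} (hHK : H ≤ K) (hA : ⁅A, A⁆ ≤ H) :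
    A ≤ normalizer ((K ⊓ A : Subgroup G) : Set G) := by
  have key : ∀ a ∈ A, ∀ b ∈ K ⊓ A, a * b * a⁻¹ ∈ K ⊓ A := by
    intro a ha b hb
    refine ⟨?_, A.mul_mem (A.mul_mem ha hb.2) (A.inv_mem ha)⟩
    have h1 := hHK (hA (commutator_mem_commutator ha hb.2))
    have h2 := K.mul_mem h1 hb.1
    simpa [commutatorElement_def, mul_assoc] using h2
  intro a ha
  refine mem_normalizer_iff.2 fun b => ⟨key a ha b, fun hb => ?_⟩
  simpa [mul_assoc] using key a⁻¹ (A.inv_mem ha) _ hb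

theorem inf_not_le_of_covBy {H A K L : Subgroup G} [A.Normal] (hHK : H ⋖ K) (hK : K ≤ H ⊔ A)
    (hL : K ⊓ L ≤ H) : ¬ K ⊓ A ≤ L := by
  intro h
  refine hHK.lt.not_ge fun k hk => ?_
  obtain ⟨a, ha, b, hb, rfl⟩ := mem_sup_of_normal_right.1 (hK hk)
  have hbK : b ∈ K := (K.mul_mem_cancel_left (hHK.le ha)).1 hk
  exact H.mul_mem ha (hL ⟨hbK, h ⟨hbK, hb⟩⟩)

/-- If the atoms over `H` are independent then some nonzero element `x` of the group algebra is
killed by every representation having a kernel which is not contained in `H`. -/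
theorem exists_ne_zero_forall_ker_le [Finite G] (H : Subgroup G)
    (hH : ∀ K, H ⋖ K → ∃ L, H ≤ L ∧ K ⊓ L ≤ H ∧ ∀ J, H ⋖ J → J ≠ K → J ≤ L) :
    ∃ x : MonoidAlgebra ℂ G, x ≠ 0 ∧
      ∀ (A : Type) [Ring A] [Algebra ℂ A] (φ : MonoidAlgebra ℂ G →ₐ[ℂ] A), φ x ≠ 0 →
        ∀ N : Subgroup G, N.Normal → (∀ n ∈ N, φ (MonoidAlgebra.of ℂ G n) = 1) → N ≤ H := by
  choose! L hHL hKL hJL using hH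
  set C := H.normalCore with hC
  have hCH : C ≤ H := H.normalCore_le
  let P : Subgroup G → Prop := fun N => N.Normal ∧ ¬ N ≤ H
  have hP : ∀ M N, Minimal P M → Minimal P N → M ≠ N → ⁅M, N⁆ ≤ C := by
    intro M N hM hN hMN
    have := hM.prop.1
    have := hN.prop.1
    refine (commutator_le_inf M N).trans (normal_le_normalCore.2 ?_)
    by_contra h
    have hMN' : P (M ⊓ N) := ⟨inferInstance, h⟩
    exact hMN (le_antisymm ((hM.le_of_le hMN' inf_le_left).trans inf_le_right)
      ((hN.le_of_le hMN' inf_le_right).trans inf_le_left))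
  set A : Subgroup G := sSup {N | Minimal P N ∧ ⁅N, N⁆ ≤ C} with hAdef
  have hAn : A.Normal := sSup_normal _ fun N hN => hN.1.prop.1
  have hAA : ⁅A, A⁆ ≤ C := by
    refine sSup_commutator_le fun M hM => ?_
    rw [commutator_comm]
    refine sSup_commutator_le fun N hN => ?_
    by_cases h : N = M
    · subst h; exact hN.2
    · exact hP _ _ hN.1 hM.1 h
  have hAM : ∀ M, Minimal P M → ¬ ⁅M, M⁆ ≤ C → ⁅A, M⁆ ≤ C := fun M hM hMM =>
    sSup_commutator_le fun N hN => hP _ _ hN.1 hM (by rintro rfl; exact hMM hN.2)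
  have hnorm : ∀ K, H ≤ K → A ≤ normalizer ((K ⊓ A : Subgroup G) : Set G) := fun K hK =>
    le_normalizer_inf hK (hAA.trans hCH)
  let F₁ : Finset (Subgroup G) := (Set.toFinite {K | H ⋖ K ∧ K ≤ H ⊔ A}).toFinset
  let F₂ : Finset (Subgroup G) := (Set.toFinite {M | Minimal P M ∧ ¬ ⁅M, M⁆ ≤ C}).toFinset
  have hF₁ : ∀ K, K ∈ F₁ ↔ H ⋖ K ∧ K ≤ H ⊔ A := by simp [F₁]
  have hF₂ : ∀ M, M ∈ F₂ ↔ Minimal P M ∧ ¬ ⁅M, M⁆ ≤ C := by simp [F₂]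
  obtain ⟨y, hy0, hy1, hy2, hy3⟩ := exists_mul_avg_eq_zero F₁ (fun K => K ⊓ A) L
    (avg_ne_zero (H ⊓ A))
    (fun K hK => avg_mem_supportedAlg (inf_le_left.trans (hHL K ((hF₁ K).1 hK).1)))
    (fun K hK J hJ hJK => inf_le_left.trans (hJL K ((hF₁ K).1 hK).1 J ((hF₁ J).1 hJ).1 hJK))
    (fun K hK => inf_not_le_of_covBy ((hF₁ K).1 hK).1 ((hF₁ K).1 hK).2
      (hKL K ((hF₁ K).1 hK).1))
    (fun K hK J hJ => commute_avg_avg (inf_le_right.trans (hnorm J ((hF₁ J).1 hJ).1.le)))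
  have hM_comm : ∀ M ∈ F₂, ∀ B : Subgroup G, Commute B.avg M.avg := fun M hM B => by
    have := ((hF₂ M).1 hM).1.prop.1
    exact commute_avg_avg (by rw [normalizer_eq_top]; exact le_top)
  obtain ⟨z, hz0, hz1, hz2, -⟩ := exists_mul_avg_eq_zero F₂ id
    (fun M => (centralizer (M.map (QuotientGroup.mk' C) : Set (G ⧸ C))).comap
      (QuotientGroup.mk' C)) hy0
    (fun M hM => by
      have hAL := commutator_le_iff_le_comap_centralizer.1
        (hAM M ((hF₂ M).1 hM).1 ((hF₂ M).1 hM).2)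
      exact mul_mem (avg_mem_supportedAlg (inf_le_right.trans hAL))
        (hy3 _ fun K _ => inf_le_right.trans hAL))
    (fun M hM N hN hMN => commutator_le_iff_le_comap_centralizer.1
      (hP _ _ ((hF₂ N).1 hN).1 ((hF₂ M).1 hM).1 hMN))
    (fun M hM h => ((hF₂ M).1 hM).2 (commutator_le_iff_le_comap_centralizer.2 h))
    (fun M _ N hN => hM_comm N hN M)
  set x := (H ⊓ A).avg * y * z with hx
  have hxK : ∀ K ∈ F₁, x * (K ⊓ A).avg = 0 := fun K hK => by
    rw [hx, mul_assoc, ← (hz2 _ fun M hM => hM_comm M hM _).eq, ← mul_assoc, hy1 K hK, zero_mul]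
  have hxD : x * (H ⊓ A).avg = x := by
    rw [hx, mul_assoc, ← (hz2 _ fun M hM => hM_comm M hM _).eq, ← mul_assoc, mul_assoc _ y,
      ← (hy2 _ fun K hK => commute_avg_avg
        (inf_le_right.trans (hnorm K ((hF₁ K).1 hK).1.le))).eq, ← mul_assoc, avg_mul_self]
  refine ⟨x, hz0, fun R _ _ φ hφ N hN hNφ => ?_⟩
  by_contra hNH
  obtain ⟨M, hMN, hM⟩ := exists_minimal_le_of_wellFoundedLT P N ⟨hN, hNH⟩
  have := hM.prop.1
  by_cases hMM : ⁅M, M⁆ ≤ C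
  · have hMA : M ≤ A := le_sSup ⟨hM, hMM⟩
    obtain ⟨K, hHK, hK⟩ := exists_covBy_le_of_lt
      (lt_of_le_of_ne (le_sup_left : H ≤ H ⊔ M) fun h => hM.prop.2 (sup_eq_left.1 h.symm))
    have hKF : K ∈ F₁ := (hF₁ K).2 ⟨hHK, hK.trans (sup_le_sup_left hMA H)⟩
    have h1 : φ (K ⊓ A).avg * φ (H ⊓ A).avg = φ (H ⊓ A).avg := by
      refine map_avg_mul φ _ _ fun b hb => ?_
      obtain ⟨h, hh, m, hm, rfl⟩ := mem_sup_of_normal_right.1 (hK hb.1)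
      have hhA : h ∈ A := (A.mul_mem_cancel_right (hMA hm)).1 hb.2
      rw [map_mul, map_mul, hNφ m (hMN hm), mul_one, ← map_mul, of_mul_avg (mem_inf.2 ⟨hh, hhA⟩)]
    apply hφ
    rw [← hxD, map_mul, ← h1, ← mul_assoc, ← map_mul, hxK K hKF, map_zero, zero_mul]
  · have h1 : φ M.avg * 1 = 1 := map_avg_mul φ _ _ fun m hm => by rw [hNφ m (hMN hm), one_mul]
    apply hφ
    have h2 : x * M.avg = 0 := hz1 M ((hF₂ M).2 ⟨hM, hMM⟩)
    rw [← mul_one (φ x), ← h1, ← mul_assoc, ← map_mul, h2, map_zero, zero_mul]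

theorem exists_complement_of_covBy {A b : Subgroup G} (hAb : A ≤ b)
    (hdist : ∀ K₁ K₂ K₃ : Subgroup G, A ≤ K₁ → K₁ ≤ b → A ≤ K₂ → K₂ ≤ b → A ≤ K₃ → K₃ ≤ b →
      K₁ ⊓ (K₂ ⊔ K₃) = (K₁ ⊓ K₂) ⊔ (K₁ ⊓ K₃))
    (hcompl : ∀ K : Subgroup G, A ≤ K → K ≤ b →
      ∃ K' : Subgroup G, A ≤ K' ∧ K' ≤ b ∧ K ⊓ K' = A ∧ K ⊔ K' = b)
    (K : Subgroup b) (hK : A.subgroupOf b ⋖ K) :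
    ∃ L, A.subgroupOf b ≤ L ∧ K ⊓ L ≤ A.subgroupOf b ∧
      ∀ J, A.subgroupOf b ⋖ J → J ≠ K → J ≤ L := by
  have hmap : (A.subgroupOf b).map b.subtype = A := map_subgroupOf_eq_of_le hAb
  have hA : ∀ J, A.subgroupOf b ⋖ J → A ≤ J.map b.subtype := fun J hJ =>
    hmap.symm.le.trans (map_mono hJ.le)
  obtain ⟨K', hAK', hK'b, hinf, hsup⟩ := hcompl _ (hA K hK) (map_subtype_le K)
  refine ⟨K'.subgroupOf b, comap_mono hAK', ?_, fun J hJ hJK => ?_⟩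
  · rw [← map_subtype_le_map_subtype, hmap, map_inf _ _ _ b.subtype_injective,
      map_subgroupOf_eq_of_le hK'b, hinf]
  · have hJK' : J ⊓ K = A.subgroupOf b := by
      refine (hJ.eq_or_eq (le_inf hJ.le hK.le) inf_le_left).resolve_right fun h => ?_
      rcases hK.eq_or_eq hJ.le (inf_eq_left.1 h) with h' | h'
      · exact hJ.lt.ne' h'
      · exact hJK h'
    have h1 := hdist _ _ _ (hA J hJ) (map_subtype_le J) (hA K hK) (map_subtype_le K) hAK' hK'b
    rw [hsup, inf_eq_left.2 (map_subtype_le J), ← map_inf _ _ _ b.subtype_injective, hJK', hmap,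
      sup_eq_right.2 (le_inf (hA J hJ) hAK')] at h1
    rw [← map_subtype_le_map_subtype, map_subgroupOf_eq_of_le hK'b]
    exact inf_eq_left.1 h1.symm

end Subgroup

/-- A bottom Boolean interval `[A, B]` yields an irreducible representation whose kernel meets `B`
in a subgroup of `A`. -/
theorem IntervalBottomBoolean.exists_irreducible {G : Type*} [Group G] [Finite G]
    {A B : Subgroup G} (hAB : A ≤ B) (h : IntervalBottomBoolean A B) :
    ∃ (n : ℕ) (ρ : Representation ℂ G (Fin n → ℂ)), Nontrivial (Fin n → ℂ) ∧
      (∀ W : Submodule ℂ (Fin n → ℂ), (∀ g : G, ∀ v ∈ W, ρ g v ∈ W) → W = ⊥ ∨ W = ⊤) ∧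
      ∀ N : Subgroup G, N.Normal → (∀ n ∈ N, ρ n = 1) → N ≤ B → N ≤ A := by
  obtain ⟨b, hb⟩ : ∃ b, b = A ⊔ sSup {K : Subgroup G | A < K ∧ K ≤ B ∧
    ∀ K' : Subgroup G, A < K' → K' ≤ K → K' = K} := ⟨_, rfl⟩
  have hAb : A ≤ b := hb ▸ le_sup_left
  obtain ⟨x, hx0, hx⟩ := (A.subgroupOf b).exists_ne_zero_forall_ker_le
    (Subgroup.exists_complement_of_covBy hAb (h b hb).1 (h b hb).2)
  let ψ := MonoidAlgebra.mapDomainAlgHom ℂ ℂ b.subtype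
  have hψ : Function.Injective ψ := MonoidAlgebra.mapDomain_injective b.subtype_injective
  obtain ⟨n, ρ, hn, hρ, hρx⟩ := exists_irreducible_asAlgebraHom_ne_zero
    ((map_ne_zero_iff ψ hψ).2 hx0)
  refine ⟨n, ρ, hn, hρ, fun N hN hNρ hNB => ?_⟩
  by_contra hNA
  obtain ⟨K, hAK, hK⟩ := exists_covBy_le_of_lt
    (lt_of_le_of_ne (le_sup_left : A ≤ A ⊔ N) fun h => hNA (sup_eq_left.1 h.symm))
  have hKb : K ≤ b := by
    rw [hb]
    refine le_sup_of_le_right (le_sSup ⟨hAK.lt, hK.trans (sup_le hAB hNB), fun K' h1 h2 => ?_⟩)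
    exact (hAK.eq_or_eq h1.le h2).resolve_left h1.ne'
  have hNb := hx _ (ρ.asAlgebraHom.comp ψ) hρx (N.subgroupOf b) inferInstance fun m hm => by
    simpa [ψ] using hNρ m hm
  refine hAK.lt.not_ge fun k hk => ?_
  obtain ⟨a, ha, m, hm, rfl⟩ := Subgroup.mem_sup_of_normal_right.1 (hK hk)
  have hmb : m ∈ b := (b.mul_mem_cancel_left (hAb ha)).1 (hKb hk)
  exact A.mul_mem ha (hNb (show (⟨m, hmb⟩ : b) ∈ N.subgroupOf b from hm))

/-- If a finite group `G` has a chain of subgroups `{e} = H₀ < H₁ < ⋯ < H_ℓ = G` with each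
interval `[Hᵢ, Hᵢ₊₁]` bottom Boolean, then there exist irreducible complex representations
`V₁, …, V_ℓ` of `G` whose direct sum is faithful, i.e. `G` has a faithful complex
representation with at most `ℓ` irreducible components. -/
theorem stmt11 {G : Type*} [Group G] [Finite G] (ℓ : ℕ) (H : Fin (ℓ + 1) → Subgroup G)
    (h0 : H 0 = ⊥) (hlast : H (Fin.last ℓ) = ⊤) (hmono : StrictMono H)
    (hstep : ∀ i : Fin ℓ, IntervalBottomBoolean (H i.castSucc) (H i.succ)) :
    ∃ (V : Fin ℓ → Type) (_ : ∀ i, AddCommGroup (V i)) (_ : ∀ i, Module ℂ (V i))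
      (_ : ∀ i, FiniteDimensional ℂ (V i)) (ρ : ∀ i, Representation ℂ G (V i)),
      (∀ i, Nontrivial (V i)) ∧
      (∀ i, ∀ W : Submodule ℂ (V i), (∀ g : G, ∀ v ∈ W, ρ i g v ∈ W) → W = ⊥ ∨ W = ⊤) ∧
      Function.Injective (fun g : G => fun i : Fin ℓ => ρ i g) := by
  choose n ρ hn hρ hker using fun i =>
    (hstep i).exists_irreducible (hmono.monotone (Fin.castSucc_lt_succ (i := i)).le)
  refine ⟨fun i => Fin (n i) → ℂ, fun i => inferInstance, fun i => inferInstance,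
    fun i => inferInstance, ρ, hn, hρ, ?_⟩
  let φ : G →* (∀ i, Module.End ℂ (Fin (n i) → ℂ)) := MonoidHom.pi ρ
  have hφ : ∀ i, φ.ker ≤ H i := by
    intro i
    induction i using Fin.reverseInduction with
    | last => rw [hlast]; exact le_top
    | cast i ih => exact hker i φ.ker inferInstance (fun m hm => congrFun hm i) ih
  exact (MonoidHom.ker_eq_bot_iff φ).1 (le_bot_iff.1 (h0 ▸ hφ 0))
end

section
/- Let 𝒜 be a (not necessarily unital) star-subalgebra of the algebra Mₙ(ℂ) of n × n complex matrices, i.e. a ℂ-linear subspace closed under matrix multiplication and conjugate transpose. Then an element x ∈ 𝒜 can be written as x = a·a* with a ∈ 𝒜 if and only if x is positive semidefinite as a matrix in Mₙ(ℂ). -/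
open scoped ComplexOrder

open scoped MatrixOrder in
/-- A (not necessarily unital) star-subalgebra of complex matrices contains the square root of each
of its positive semidefinite elements. -/
theorem NonUnitalStarSubalgebra.sqrt_mem_of_posSemidef {n : Type*} [Fintype n] [DecidableEq n]
    (S : NonUnitalStarSubalgebra ℂ (Matrix n n ℂ)) {x : Matrix n n ℂ} (hx : x ∈ S)
    (hpos : x.PosSemidef) : CFC.sqrt x ∈ S := by
  have : IsClosed (S : Set (Matrix n n ℂ)) :=
    S.toNonUnitalSubalgebra.toSubmodule.closed_of_finiteDimensional
  rw [CFC.sqrt_eq_real_sqrt x hpos.nonneg]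
  exact cfcₙ_mem (𝕜' := ℂ) _ hx

open scoped MatrixOrder in
/-- A positive semidefinite element of a (not necessarily unital) star-subalgebra of complex
matrices factors as `a * star a` inside the subalgebra. -/
theorem NonUnitalStarSubalgebra.exists_eq_mul_star_of_posSemidef {n : Type*} [Fintype n]
    [DecidableEq n] (S : NonUnitalStarSubalgebra ℂ (Matrix n n ℂ)) {x : Matrix n n ℂ} (hx : x ∈ S)
    (hpos : x.PosSemidef) : ∃ a ∈ S, x = a * star a := by
  refine ⟨CFC.sqrt x, S.sqrt_mem_of_posSemidef hx hpos, ?_⟩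
  rw [(CFC.sqrt_nonneg x).isSelfAdjoint.star_eq, CFC.sqrt_mul_sqrt_self x hpos.nonneg]

/-- Let `𝒜` be a (not necessarily unital) star-subalgebra of `Mₙ(ℂ)`: a `ℂ`-linear
subspace closed under matrix multiplication and conjugate transpose. Then `x ∈ 𝒜` can be
written `x = a * aᴴ` with `a ∈ 𝒜` if and only if `x` is positive semidefinite. -/
theorem stmt13 {n : ℕ} (𝒜 : Submodule ℂ (Matrix (Fin n) (Fin n) ℂ))
    (hmul : ∀ a ∈ 𝒜, ∀ b ∈ 𝒜, a * b ∈ 𝒜)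
    (hstar : ∀ a ∈ 𝒜, star a ∈ 𝒜)
    (x : Matrix (Fin n) (Fin n) ℂ) (hx : x ∈ 𝒜) :
    (∃ a ∈ 𝒜, x = a * star a) ↔ x.PosSemidef := by
  constructor
  · rintro ⟨a, -, rfl⟩
    exact Matrix.posSemidef_self_mul_conjTranspose a
  · let S : NonUnitalStarSubalgebra ℂ (Matrix (Fin n) (Fin n) ℂ) :=
      { 𝒜 with
        mul_mem' := fun {a b} ha hb => hmul a ha b hb
        star_mem' := fun {a} ha => hstar a ha }
    exact S.exists_eq_mul_star_of_posSemidef hx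
end
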